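/- Let Γ be a finite connected simple graph with no triangles which is not the star of a single vertex. Let ν be the number of vertices, ν_0 the number of maximal link-equivalence classes of vertices, and π the number of pieces of Γ. Then Out(A_Γ) contains a free abelian subgroup of rank (π−1) + 2(ν−ν_0) − 2. If moreover Γ_0 is a subgraph spanned by one chosen vertex from each maximal equivalence class and some vertex of Γ_0 is not a hub, then Out(A_Γ) contains a free abelian subgroup of rank (π−1) + 2(ν−ν_0) − 1; and if some edge of Γ_0 has neither endpoint a hub, then Out(A_Γ) contains a free abelian subgroup of rank (π−1) + 2(ν−ν_0). -/

import Mathlib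

/-- The relators of a right-angled Artin group: commutators of adjacent generators. -/
def raagRels {V : Type*} (Γ : SimpleGraph V) : Set (FreeGroup V) :=
  {r | ∃ v w : V, Γ.Adj v w ∧
    r = FreeGroup.of v * FreeGroup.of w * (FreeGroup.of v)⁻¹ * (FreeGroup.of w)⁻¹}

/-- The right-angled Artin group of a simple graph. -/
abbrev RAAG {V : Type*} (Γ : SimpleGraph V) : Type _ := PresentedGroup (raagRels Γ)

/-- The generator of `RAAG Γ` corresponding to a vertex. -/
def raagGen {V : Type*} (Γ : SimpleGraph V) (v : V) : RAAG Γ := PresentedGroup.of v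

instance innerAutNormal (G : Type*) [Group G] :
    ((MulAut.conj : G →* MulAut G).range).Normal := by
  constructor
  intro x hx φ
  obtain ⟨g, rfl⟩ := hx
  refine ⟨φ g, ?_⟩
  ext y
  simp [MulAut.conj]

abbrev OutG (G : Type*) [Group G] : Type _ :=
  MulAut G ⧸ ((MulAut.conj : G →* MulAut G).range)

def outMk (G : Type*) [Group G] : MulAut G →* OutG G :=
  QuotientGroup.mk' _

/-- `v` is a leaf: it has exactly one neighbor. -/
def IsLeaf {V : Type*} (Γ : SimpleGraph V) (v : V) : Prop :=
  (Γ.neighborSet v).ncard = 1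

/-- The number of leaves. -/
noncomputable def numLeaves {V : Type*} (Γ : SimpleGraph V) : ℕ :=
  {v | IsLeaf Γ v}.ncard

/-- A subgraph has no separating vertex: deleting any of its vertices leaves it connected. -/
def NoCutVertex {V : Type*} {Γ : SimpleGraph V} (H : Γ.Subgraph) : Prop :=
  ∀ v ∈ H.verts, (H.deleteVerts {v}).Connected

/-- A piece (block) of `Γ`: a maximal connected subgraph with at least one edge
having no separating vertex (a single edge counts as a piece). -/
def IsPiece {V : Type*} (Γ : SimpleGraph V) (H : Γ.Subgraph) : Prop :=
  H.Connected ∧ H.edgeSet.Nonempty ∧ NoCutVertex H ∧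
    ∀ H' : Γ.Subgraph, H'.Connected → H'.edgeSet.Nonempty → NoCutVertex H' →
      H ≤ H' → H' = H

/-- The number of pieces of `Γ`. -/
noncomputable def numPieces {V : Type*} (Γ : SimpleGraph V) : ℕ :=
  Nat.card {H : Γ.Subgraph // IsPiece Γ H}

/-- `u` and `w` are connected by a walk in `Γ` avoiding the vertex `v`
(i.e. they lie in the same connected component of `Γ ∖ {v}`). -/
def ReachAvoid {V : Type*} (Γ : SimpleGraph V) (v u w : V) : Prop :=
  ∃ p : Γ.Walk u w, v ∉ p.support

/-- There is an injective homomorphism from the free abelian group of rank `r` into `G`. -/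
def HasFreeAbelianSubgroupOfRank (G : Type*) [Group G] (r : ℕ) : Prop :=
  ∃ f : Multiplicative (Fin r →₀ ℤ) →* G, Function.Injective f

/-- The vertex `v` lies in a maximal link-equivalence class: vertices are
preordered by `v ≤ w ↔ lk(v) ⊆ lk(w)`, and the class of `v` is maximal in the
induced partial order. -/
def IsMaxVert {V : Type*} (Γ : SimpleGraph V) (v : V) : Prop :=
  ∀ w : V, Γ.neighborSet v ⊆ Γ.neighborSet w → Γ.neighborSet w = Γ.neighborSet v

/-- The number `ν₀` of maximal link-equivalence classes of vertices. -/
noncomputable def numMaxClasses {V : Type*} (Γ : SimpleGraph V) : ℕ :=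
  {L : Set V | ∃ v : V, IsMaxVert Γ v ∧ Γ.neighborSet v = L}.ncard

/-- `S₀` consists of one chosen vertex from each maximal link-equivalence class
(the vertex set of the subgraph `Γ₀`). -/
def IsSelection {V : Type*} (Γ : SimpleGraph V) (S₀ : Set V) : Prop :=
  (∀ v ∈ S₀, IsMaxVert Γ v) ∧
  (∀ v : V, IsMaxVert Γ v → ∃ w ∈ S₀, Γ.neighborSet w = Γ.neighborSet v) ∧
  (∀ w ∈ S₀, ∀ w' ∈ S₀, Γ.neighborSet w = Γ.neighborSet w' → w = w')

/-- `Δ(v)`: the union of (the vertex sets of) all pieces of `Γ` containing `v`. -/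
def pieceStar {V : Type*} (Γ : SimpleGraph V) (v : V) : Set V :=
  {u | ∃ H : Γ.Subgraph, IsPiece Γ H ∧ v ∈ H.verts ∧ u ∈ H.verts}

/-- `v` is a hub: every vertex of `Δ(v)` is adjacent to `v` or has link
contained in the link of `v`. -/
def IsHub {V : Type*} (Γ : SimpleGraph V) (v : V) : Prop :=
  ∀ u ∈ pieceStar Γ v, Γ.Adj v u ∨ Γ.neighborSet u ⊆ Γ.neighborSet v

namespace FreeGroup

/-- An element of a free group commuting with a free generator is a power of it. -/
theorem exists_eq_zpow_of_commute_of {α : Type*} (a : α) (g : FreeGroup α)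
    (h : Commute (of a) g) : ∃ n : ℤ, g = of a ^ n := by
  classical
  induction hn : g.norm using Nat.strong_induction_on generalizing g with
  | _ n ih =>
    subst hn
    have hg : mk g.toWord = g := mk_toWord
    rcases hW : g.toWord with _ | ⟨⟨b, e⟩, L⟩
    · exact ⟨0, by simpa using toWord_eq_nil_iff.mp hW⟩
    · rw [hW] at hg
      have hred : IsReduced ((b, e) :: L) := hW ▸ isReduced_toWord
      have hnorm : (mk L).norm < g.norm := by
        have h1 : g.norm = L.length + 1 := by simp [norm, hW]
        have h2 : (mk L).norm ≤ L.length := norm_mk_le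
        omega
      by_cases hba : b = a
      · subst hba
        have hsplit : g = mk [(b, e)] * mk L := by rw [← hg, mul_mk]; rfl
        have hpow : ∃ k : ℤ, mk [(b, e)] = of b ^ k := by
          cases e
          · exact ⟨-1, by rw [zpow_neg_one]; rfl⟩
          · exact ⟨1, by rw [zpow_one]; rfl⟩
        obtain ⟨k, hk⟩ := hpow
        have hL : mk L = of b ^ (-k) * g := by rw [hsplit, hk]; group
        have hcomm : Commute (of b) (mk L) := by
          rw [hL]
          exact ((Commute.refl (of b)).zpow_right _).mul_right h
        obtain ⟨m, hm⟩ := ih _ hnorm _ hcomm rfl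
        exact ⟨k + m, by rw [hsplit, hk, hm, zpow_add]⟩
      · exfalso
        have hleft : (of a * g).toWord = (a, true) :: (b, e) :: L := by
          rw [toWord_mul, toWord_of, hW, List.singleton_append]
          apply IsReduced.reduce_eq
          rw [isReduced_cons_cons]
          exact ⟨fun hab => absurd hab.symm hba, hred⟩
        have hright : (of a * g).toWord = ((b, e) :: L) ++ [(a, true)] := by
          have hsub := toWord_mul_sublist g (of a)
          rw [← h.eq, hW, toWord_of] at hsub
          exact hsub.eq_of_length (by rw [hleft]; simp)
        rw [hleft] at hright
        simp only [List.cons_append, List.cons.injEq, Prod.mk.injEq] at hright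
        exact hba hright.1.1.symm

/-- The exponent sum of a generator. -/
noncomputable def expSum {α : Type*} (a : α) : FreeGroup α →* Multiplicative ℤ :=
  open Classical in lift (Pi.mulSingle a (Multiplicative.ofAdd 1))

theorem expSum_self {α : Type*} (a : α) : expSum a (of a) = Multiplicative.ofAdd 1 := by
  simp [expSum]

theorem expSum_of_ne {α : Type*} {a b : α} (h : b ≠ a) : expSum a (of b) = 1 := by
  simp [expSum, h]

theorem zpow_eq_one_of_commute {α : Type*} {a b : α} (hab : a ≠ b) {k : ℤ}
    (h : Commute (of b) (of a ^ k)) : k = 0 := by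
  obtain ⟨n, hn⟩ := exists_eq_zpow_of_commute_of b _ h
  have := congrArg (expSum a) hn
  rw [map_zpow, map_zpow, expSum_self, expSum_of_ne hab.symm, one_zpow] at this
  have h2 := congrArg Multiplicative.toAdd this
  simpa using h2

theorem eq_neg_of_conj_eq {α : Type*} {a b : α} (hab : a ≠ b) {c p q : ℤ}
    (h : of a ^ c * of b * (of a ^ c)⁻¹ = of a ^ p * of b * of a ^ q) : q = -c := by
  have h1 := congrArg (expSum a) h
  simp only [_root_.map_mul, _root_.map_inv, map_zpow, expSum_self, expSum_of_ne hab.symm] at h1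
  have hpq : p = -q := by
    have h2 : p + q = 0 := by
      have := congrArg Multiplicative.toAdd h1
      simp only [mul_one, mul_inv_cancel, toAdd_one, toAdd_mul, toAdd_zpow, toAdd_ofAdd,
        smul_eq_mul] at this
      omega
    omega
  subst hpq
  have h3 : Commute (of b) (of a ^ (q + c)) := by
    have h4 : of b * of a ^ (q + c) = of a ^ (q + c) * of b := by
      calc of b * of a ^ (q + c)
          = of a ^ q * (of a ^ (-q) * of b * of a ^ q) * of a ^ c := by group
        _ = of a ^ q * (of a ^ c * of b * (of a ^ c)⁻¹) * of a ^ c := by rw [h]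
        _ = of a ^ (q + c) * of b := by group
    exact h4
  have := zpow_eq_one_of_commute hab h3
  omega

end FreeGroup

section RAAG

variable {V : Type*} (Γ : SimpleGraph V)

/-- The homomorphism out of a right-angled Artin group determined by images of the generators. -/
def raagLift {G : Type*} [Group G] (f : V → G)
    (h : ∀ v w, Γ.Adj v w → Commute (f v) (f w)) : RAAG Γ →* G :=
  PresentedGroup.toGroup (f := f) (by
    rintro _ ⟨v, w, hvw, rfl⟩
    simp only [map_mul, map_inv, FreeGroup.lift_apply_of]
    rw [(h v w hvw).eq]
    group)

@[simp]
theorem raagLift_gen {G : Type*} [Group G] (f : V → G)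
    (h : ∀ v w, Γ.Adj v w → Commute (f v) (f w)) (v : V) :
    raagLift Γ f h (raagGen Γ v) = f v :=
  PresentedGroup.toGroup.of _

theorem raag_hom_ext {G : Type*} [Group G] {φ ψ : RAAG Γ →* G}
    (h : ∀ v, φ (raagGen Γ v) = ψ (raagGen Γ v)) : φ = ψ :=
  PresentedGroup.ext h

theorem raagGen_commute {v w : V} (h : Γ.Adj v w) : Commute (raagGen Γ v) (raagGen Γ w) := by
  have h1 : (PresentedGroup.mk (raagRels Γ)) (FreeGroup.of v * FreeGroup.of w *
      (FreeGroup.of v)⁻¹ * (FreeGroup.of w)⁻¹) = 1 :=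
    PresentedGroup.one_of_mem ⟨v, w, h, rfl⟩
  simp only [map_mul, map_inv] at h1
  exact (mul_inv_eq_iff_eq_mul.mp (mul_inv_eq_one.mp h1))

/-- The exponent sum of a vertex in an element of a right-angled Artin group. -/
noncomputable def raagExp (u : V) : RAAG Γ →* Multiplicative ℤ :=
  open Classical in
  raagLift Γ (Pi.mulSingle u (Multiplicative.ofAdd 1)) fun _ _ _ => Commute.all _ _

theorem raagExp_self (u : V) : raagExp Γ u (raagGen Γ u) = Multiplicative.ofAdd 1 := by
  simp [raagExp]

theorem raagExp_of_ne {u v : V} (h : v ≠ u) : raagExp Γ u (raagGen Γ v) = 1 := by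
  simp [raagExp, h]

/-- The retraction onto the free group on two nonadjacent vertices. -/
noncomputable def raagPair {u x : V} (hux : ¬ Γ.Adj u x) : RAAG Γ →* FreeGroup V :=
  open Classical in
  raagLift Γ (fun y => if y = u ∨ y = x then FreeGroup.of y else 1) (by
    intro v w hvw
    by_cases hv : v = u ∨ v = x
    · by_cases hw : w = u ∨ w = x
      · exfalso
        rcases hv with rfl | rfl <;> rcases hw with rfl | rfl <;>
          first
            | exact Γ.irrefl hvw
            | exact hux hvw
            | exact hux hvw.symm
      · simp only [if_neg hw]; exact Commute.one_right _
    · simp only [if_neg hv]; exact Commute.one_left _)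

theorem raagPair_left {u x : V} (hux : ¬ Γ.Adj u x) :
    raagPair Γ hux (raagGen Γ u) = FreeGroup.of u := by
  simp [raagPair]

theorem raagPair_right {u x : V} (hux : ¬ Γ.Adj u x) :
    raagPair Γ hux (raagGen Γ x) = FreeGroup.of x := by
  simp [raagPair]

theorem raagPair_of_ne {u x y : V} (hux : ¬ Γ.Adj u x) (hyu : y ≠ u) (hyx : y ≠ x) :
    raagPair Γ hux (raagGen Γ y) = 1 := by
  simp [raagPair, hyu, hyx]

theorem expSum_raagPair {u x : V} (hux : ¬ Γ.Adj u x) (g : RAAG Γ) :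
    FreeGroup.expSum u (raagPair Γ hux g) = raagExp Γ u g := by
  have : (FreeGroup.expSum u).comp (raagPair Γ hux) = raagExp Γ u := by
    apply raag_hom_ext
    intro y
    rw [MonoidHom.comp_apply]
    by_cases hyu : y = u
    · subst hyu
      rw [raagPair_left, FreeGroup.expSum_self, raagExp_self]
    · rw [raagExp_of_ne Γ hyu]
      by_cases hyx : y = x
      · subst hyx
        rw [raagPair_right, FreeGroup.expSum_of_ne hyu]
      · rw [raagPair_of_ne Γ hux hyu hyx, map_one]
  exact DFunLike.congr_fun this g

theorem raagPair_eq_zpow_of_commute {u x : V} (hux : ¬ Γ.Adj u x) {g : RAAG Γ}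
    (h : Commute (FreeGroup.of u) (raagPair Γ hux g)) :
    raagPair Γ hux g = FreeGroup.of u ^ (Multiplicative.toAdd (raagExp Γ u g)) := by
  obtain ⟨n, hn⟩ := FreeGroup.exists_eq_zpow_of_commute_of u _ h
  have h2 := expSum_raagPair Γ hux g
  rw [hn, map_zpow, FreeGroup.expSum_self] at h2
  rw [hn, ← h2]
  simp

/-- An element commuting with `y` has no exponent sum in vertices not adjacent to `y`. -/
theorem raagExp_eq_one_of_commute {y u : V} (hyu : ¬ Γ.Adj y u) (hne : y ≠ u) {g : RAAG Γ}
    (h : Commute (raagGen Γ y) g) : raagExp Γ u g = 1 := by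
  have huy : ¬ Γ.Adj u y := fun h' => hyu h'.symm
  have h1 := h.map (raagPair Γ huy)
  rw [raagPair_right] at h1
  obtain ⟨n, hn⟩ := FreeGroup.exists_eq_zpow_of_commute_of y _ h1
  rw [← expSum_raagPair Γ huy, hn, map_zpow, FreeGroup.expSum_of_ne hne, one_zpow]

/-- The combinatorial data of a partial conjugation (`ε = 1`) of the vertices in `D` by `t`, or of
a left transvection (`ε = 0`) of the single vertex in `D` by `t`. -/
structure IsTwist (t : V) (D : Set V) (ε : ℤ) : Prop where
  not_mem : t ∉ D
  boundary : ∀ y ∈ D, ∀ z, Γ.Adj y z → z ∉ D → z = t ∨ Γ.Adj t z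
  type : ε = 1 ∨ (ε = 0 ∧ ∃ w, D = {w})

variable {Γ}

open Classical in
/-- The image of a generator under the `n`-th power of a twist. -/
noncomputable def twistFun (Γ : SimpleGraph V) (t : V) (D : Set V) (ε n : ℤ) (y : V) : RAAG Γ :=
  if y ∈ D then raagGen Γ t ^ n * raagGen Γ y * raagGen Γ t ^ (-(ε * n)) else raagGen Γ y

theorem twistFun_mem {t : V} {D : Set V} {ε n : ℤ} {y : V} (h : y ∈ D) :
    twistFun Γ t D ε n y = raagGen Γ t ^ n * raagGen Γ y * raagGen Γ t ^ (-(ε * n)) := by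
  simp only [twistFun, if_pos h]

theorem twistFun_not_mem {t : V} {D : Set V} {ε n : ℤ} {y : V} (h : y ∉ D) :
    twistFun Γ t D ε n y = raagGen Γ y := by
  simp only [twistFun, if_neg h]

theorem twistFun_commute_of_not_mem {t : V} {D : Set V} {ε : ℤ} (h : IsTwist Γ t D ε) (n : ℤ)
    {v w : V} (hvw : Γ.Adj v w) (hv : v ∈ D) (hw : w ∉ D) :
    Commute (twistFun Γ t D ε n v) (twistFun Γ t D ε n w) := by
  rw [twistFun_mem hv, twistFun_not_mem hw]
  have htw : Commute (raagGen Γ t) (raagGen Γ w) := by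
    rcases h.boundary v hv w hvw hw with rfl | h'
    · exact Commute.refl _
    · exact raagGen_commute Γ h'
  exact ((htw.zpow_left _).mul_left (raagGen_commute Γ hvw)).mul_left (htw.zpow_left _)

theorem twistFun_commute {t : V} {D : Set V} {ε : ℤ} (h : IsTwist Γ t D ε) (n : ℤ)
    (v w : V) (hvw : Γ.Adj v w) :
    Commute (twistFun Γ t D ε n v) (twistFun Γ t D ε n w) := by
  by_cases hv : v ∈ D <;> by_cases hw : w ∈ D
  · rcases h.type with rfl | ⟨_, x, rfl⟩
    · rw [twistFun_mem hv, twistFun_mem hw, one_mul, zpow_neg]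
      have := (raagGen_commute Γ hvw).map (MulAut.conj (raagGen Γ t ^ n)).toMonoidHom
      simpa only [MulEquiv.toMonoidHom_eq_coe, MonoidHom.coe_coe, MulAut.conj_apply] using this
    · rw [Set.mem_singleton_iff] at hv hw
      exact absurd hvw (by rw [hv, hw]; exact Γ.irrefl)
  · exact twistFun_commute_of_not_mem h n hvw hv hw
  · exact (twistFun_commute_of_not_mem h n hvw.symm hw hv).symm
  · rw [twistFun_not_mem hv, twistFun_not_mem hw]
    exact raagGen_commute Γ hvw

/-- The `n`-th power of a twist as an endomorphism. -/
noncomputable def twistHom {t : V} {D : Set V} {ε : ℤ} (h : IsTwist Γ t D ε) (n : ℤ) :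
    RAAG Γ →* RAAG Γ :=
  raagLift Γ (twistFun Γ t D ε n) (twistFun_commute h n)

theorem twistHom_gen_mem {t : V} {D : Set V} {ε : ℤ} (h : IsTwist Γ t D ε) (n : ℤ) {y : V}
    (hy : y ∈ D) : twistHom h n (raagGen Γ y) =
      raagGen Γ t ^ n * raagGen Γ y * raagGen Γ t ^ (-(ε * n)) := by
  rw [twistHom, raagLift_gen, twistFun_mem hy]

theorem twistHom_gen_not_mem {t : V} {D : Set V} {ε : ℤ} (h : IsTwist Γ t D ε) (n : ℤ) {y : V}
    (hy : y ∉ D) : twistHom h n (raagGen Γ y) = raagGen Γ y := by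
  rw [twistHom, raagLift_gen, twistFun_not_mem hy]

theorem twistHom_comp {t : V} {D : Set V} {ε : ℤ} (h : IsTwist Γ t D ε) (m n : ℤ) :
    (twistHom h m).comp (twistHom h n) = twistHom h (m + n) := by
  apply raag_hom_ext
  intro y
  rw [MonoidHom.comp_apply]
  by_cases hy : y ∈ D
  · simp only [twistHom_gen_mem h _ hy, map_mul, map_zpow, twistHom_gen_not_mem h m h.not_mem]
    group
  · simp only [twistHom_gen_not_mem h _ hy]

theorem twistHom_zero {t : V} {D : Set V} {ε : ℤ} (h : IsTwist Γ t D ε) :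
    twistHom h 0 = MonoidHom.id _ := by
  apply raag_hom_ext
  intro y
  by_cases hy : y ∈ D
  · simp [twistHom_gen_mem h _ hy]
  · simp [twistHom_gen_not_mem h _ hy]

/-- The cyclic group of automorphisms generated by a twist. -/
noncomputable def twistAut {t : V} {D : Set V} {ε : ℤ} (h : IsTwist Γ t D ε) :
    Multiplicative ℤ →* MulAut (RAAG Γ) where
  toFun n := MonoidHom.toMulEquiv (twistHom h n.toAdd) (twistHom h (-n.toAdd))
    (by rw [twistHom_comp, neg_add_cancel, twistHom_zero])
    (by rw [twistHom_comp, add_neg_cancel, twistHom_zero])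
  map_one' := by
    ext x
    exact DFunLike.congr_fun (twistHom_zero h) x
  map_mul' m n := by
    ext x
    exact (DFunLike.congr_fun (twistHom_comp h m.toAdd n.toAdd) x).symm

theorem twistAut_apply {t : V} {D : Set V} {ε : ℤ} (h : IsTwist Γ t D ε) (n : Multiplicative ℤ)
    (x : RAAG Γ) : twistAut h n x = twistHom h n.toAdd x := rfl

/-- Sufficient condition for two twists to commute. -/
def TwistsCommute (Γ : SimpleGraph V) (t : V) (D : Set V) (ε : ℤ) (t' : V) (D' : Set V) : Prop :=
  (t ∉ D' ∧ t' ∉ D ∧ (t = t' ∨ Disjoint D D' ∨ Γ.Adj t t')) ∨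
    (t' ∈ D ∧ t ∉ D' ∧ D' ⊆ D ∧ ε = 1)

theorem commute_twistAut {t t' : V} {D D' : Set V} {ε ε' : ℤ} (h : IsTwist Γ t D ε)
    (h' : IsTwist Γ t' D' ε') (hc : TwistsCommute Γ t D ε t' D') (m n : Multiplicative ℤ) :
    Commute (twistAut h m) (twistAut h' n) := by
  suffices key : (twistHom h m.toAdd).comp (twistHom h' n.toAdd) =
      (twistHom h' n.toAdd).comp (twistHom h m.toAdd) by
    ext x
    exact DFunLike.congr_fun key x
  apply raag_hom_ext
  intro y
  generalize m.toAdd = m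
  generalize n.toAdd = n
  simp only [MonoidHom.comp_apply]
  rcases hc with ⟨ht, ht', hc⟩ | ⟨ht', ht, hD, rfl⟩
  · by_cases hy : y ∈ D <;> by_cases hy' : y ∈ D'
    · have hcomm : Commute (raagGen Γ t) (raagGen Γ t') := by
        rcases hc with rfl | hdis | hadj
        · exact Commute.refl _
        · exact absurd hy' (Set.disjoint_left.mp hdis hy)
        · exact raagGen_commute Γ hadj
      simp only [twistHom_gen_mem _ _ hy, twistHom_gen_mem _ _ hy', map_mul, map_zpow,
        twistHom_gen_not_mem _ _ ht, twistHom_gen_not_mem _ _ ht']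
      have e1 := (hcomm.zpow_zpow m n).eq
      have e2 := (hcomm.zpow_zpow (-(ε * m)) (-(ε' * n))).eq
      simp only [mul_assoc]
      rw [e2]
      simp only [← mul_assoc]
      rw [e1]
    · simp only [twistHom_gen_mem _ _ hy, twistHom_gen_not_mem _ _ hy', map_mul, map_zpow,
        twistHom_gen_not_mem _ _ ht]
    · simp only [twistHom_gen_mem _ _ hy', twistHom_gen_not_mem _ _ hy, map_mul, map_zpow,
        twistHom_gen_not_mem _ _ ht']
    · simp only [twistHom_gen_not_mem _ _ hy', twistHom_gen_not_mem _ _ hy]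
  · by_cases hy' : y ∈ D'
    · have hy := hD hy'
      simp only [twistHom_gen_mem _ _ hy, twistHom_gen_mem _ _ hy', map_mul, map_zpow,
        twistHom_gen_not_mem h' _ ht, twistHom_gen_mem h _ ht', one_mul, zpow_neg, map_inv,
        conj_zpow]
      group
    · by_cases hy : y ∈ D
      · simp only [twistHom_gen_mem _ _ hy, twistHom_gen_not_mem _ _ hy', map_mul, map_zpow,
          twistHom_gen_not_mem _ _ ht]
      · simp only [twistHom_gen_not_mem _ _ hy', twistHom_gen_not_mem _ _ hy]

/-- The endomorphism of a free group sending `x` to `u ^ p * x * u ^ q` and fixing all other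
generators. -/
noncomputable def pairEnd (u x : V) (c : ℤ × ℤ) : FreeGroup V →* FreeGroup V :=
  open Classical in
  FreeGroup.lift fun y =>
    if y = x then FreeGroup.of u ^ c.1 * FreeGroup.of x * FreeGroup.of u ^ c.2 else FreeGroup.of y

theorem pairEnd_self (u x : V) (c : ℤ × ℤ) : pairEnd u x c (FreeGroup.of x) =
    FreeGroup.of u ^ c.1 * FreeGroup.of x * FreeGroup.of u ^ c.2 := by
  simp [pairEnd]

theorem pairEnd_of_ne {u x y : V} (h : y ≠ x) (c : ℤ × ℤ) :
    pairEnd u x c (FreeGroup.of y) = FreeGroup.of y := by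
  simp [pairEnd, h]

theorem pairEnd_zero (u x : V) : pairEnd u x 0 = MonoidHom.id _ := by
  ext y
  by_cases h : y = x
  · subst h; simp [pairEnd_self]
  · simp [pairEnd_of_ne h]

theorem pairEnd_add {u x : V} (h : u ≠ x) (c d : ℤ × ℤ) :
    pairEnd u x (c + d) = (pairEnd u x c).comp (pairEnd u x d) := by
  ext y
  rw [MonoidHom.comp_apply]
  by_cases hy : y = x
  · subst hy
    simp only [pairEnd_self, map_mul, map_zpow, pairEnd_of_ne h, Prod.fst_add, Prod.snd_add]
    rw [add_comm c.1, zpow_add, zpow_add]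
    group
  · simp only [pairEnd_of_ne hy]

/-- The endomorphism `(a, b) ↦ (a, b * a ^ c)`. -/
def shearEnd (c : ℤ) : Multiplicative ℤ × Multiplicative ℤ →* Multiplicative ℤ × Multiplicative ℤ :=
  (MonoidHom.fst _ _).prod (MonoidHom.snd _ _ * (MonoidHom.fst _ _) ^ c)

theorem shearEnd_apply (c : ℤ) (a : Multiplicative ℤ × Multiplicative ℤ) :
    shearEnd c a = (a.1, a.2 * a.1 ^ c) := rfl

/-- A family of pairwise commuting twists by elements of `S`. -/
structure TwistFamily (Γ : SimpleGraph V) (I : Type*) where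
  /-- the vertices used as multipliers -/
  S : Set V
  /-- the multiplier of each twist -/
  t : I → V
  /-- the support of each twist -/
  D : I → Set V
  /-- the type of each twist -/
  ε : I → ℤ
  isTwist : ∀ i, IsTwist Γ (t i) (D i) (ε i)
  commute : Pairwise fun i j => TwistsCommute Γ (t i) (D i) (ε i) (t j) (D j) ∨
    TwistsCommute Γ (t j) (D j) (ε j) (t i) (D i)
  t_mem : ∀ i, t i ∈ S
  disjoint : ∀ i, ε i = 0 → ∀ y ∈ D i, y ∉ S

namespace TwistFamily

variable {I : Type*} [Fintype I] (T : TwistFamily Γ I)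

/-- The action of the free abelian group on a commuting family of twists. -/
noncomputable def toAut : Multiplicative (I →₀ ℤ) →* MulAut (RAAG Γ) :=
  (MonoidHom.noncommPiCoprod (fun i => twistAut (T.isTwist i)) (fun i j hij x y => by
      rcases T.commute hij with h | h
      · exact commute_twistAut _ _ h x y
      · exact (commute_twistAut _ _ h y x).symm)).comp
    { toFun := fun f i => Multiplicative.ofAdd (f.toAdd i)
      map_one' := rfl
      map_mul' := fun _ _ => rfl }

theorem toAut_single (i : I) (n : ℤ) (x : RAAG Γ) :
    T.toAut (Multiplicative.ofAdd (Finsupp.single i n)) x = twistHom (T.isTwist i) n x := by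
  classical
  have h : (fun j => Multiplicative.ofAdd ((Finsupp.single i n) j)) =
      (Pi.mulSingle i (Multiplicative.ofAdd n) : I → Multiplicative ℤ) := by
    funext j
    by_cases hj : j = i
    · subst hj; simp
    · simp [hj]
  have h2 : T.toAut (Multiplicative.ofAdd (Finsupp.single i n)) =
      twistAut (T.isTwist i) (Multiplicative.ofAdd n) := by
    rw [toAut, MonoidHom.comp_apply]
    refine (congrArg _ h).trans ?_
    exact MonoidHom.noncommPiCoprod_mulSingle _ i _
  rw [h2, twistAut_apply, toAdd_ofAdd]

/-- If each twist of the family induces an endomorphism on the image of the subgroup generated by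
some vertices, then so does each element of the group they generate. -/
theorem toAut_induced {G M : Type*} [Group G] [AddCommGroup M] (ρ : RAAG Γ →* G)
    (ψ : M → G →* G) (h0 : ψ 0 = MonoidHom.id _) (hadd : ∀ a b, ψ (a + b) = (ψ a).comp (ψ b))
    (Y : Set V) (c : I → M)
    (h : ∀ i n, ∀ y ∈ Y,
      twistHom (T.isTwist i) n (raagGen Γ y) ∈ Subgroup.closure (raagGen Γ '' Y) ∧
      ρ (twistHom (T.isTwist i) n (raagGen Γ y)) = ψ (n • c i) (ρ (raagGen Γ y)))
    (f : I →₀ ℤ) : ∀ b ∈ Subgroup.closure (raagGen Γ '' Y),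
      T.toAut (Multiplicative.ofAdd f) b ∈ Subgroup.closure (raagGen Γ '' Y) ∧
      ρ (T.toAut (Multiplicative.ofAdd f) b) = ψ (∑ i, f i • c i) (ρ b) := by
  classical
  induction f using Finsupp.induction_linear with
  | zero => intro b hb; simp [h0, hb]
  | add f g hf hg =>
    intro b hb
    obtain ⟨hb1, hb2⟩ := hg b hb
    obtain ⟨hb3, hb4⟩ := hf _ hb1
    have hsum : ∑ i, (f + g) i • c i = ∑ i, f i • c i + ∑ i, g i • c i := by
      simp [add_smul, Finset.sum_add_distrib]
    rw [ofAdd_add, map_mul, MulAut.mul_apply, hsum, hadd, MonoidHom.comp_apply, ← hb2]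
    exact ⟨hb3, hb4⟩
  | single i n =>
    intro b hb
    have hsum : ∑ j, (Finsupp.single i n) j • c j = n • c i := by
      rw [Finset.sum_eq_single i]
      · simp
      · intro j _ hj; simp [hj.symm]
      · simp
    rw [toAut_single, hsum]
    induction hb using Subgroup.closure_induction with
    | mem x hx =>
      obtain ⟨y, hy, rfl⟩ := hx
      exact h i n y hy
    | one => simp [one_mem]
    | mul x y _ _ hx hy =>
      simp only [map_mul]
      exact ⟨mul_mem hx.1 hy.1, by rw [hx.2, hy.2]⟩
    | inv x _ hx =>
      simp only [map_inv]
      exact ⟨inv_mem hx.1, by rw [hx.2]⟩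

theorem toAut_gen_of_fixed {r : V} (hr : ∀ i, r ∉ T.D i) (f : I →₀ ℤ) :
    T.toAut (Multiplicative.ofAdd f) (raagGen Γ r) = raagGen Γ r := by
  have := T.toAut_induced (MonoidHom.id _) (fun _ : ℤ => MonoidHom.id _) rfl (fun _ _ => rfl) {r}
    (fun _ => 0) (by
      rintro i n y rfl
      rw [twistHom_gen_not_mem _ _ (hr i)]
      exact ⟨Subgroup.subset_closure ⟨y, rfl, rfl⟩, rfl⟩) f (raagGen Γ r)
    (Subgroup.subset_closure ⟨r, rfl, rfl⟩)
  exact this.2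

omit [Fintype I] in
theorem twistHom_mem_closure {x : V} (i : I) (n : ℤ) {y : V} (hy : y ∈ T.S ∪ {x}) :
    twistHom (T.isTwist i) n (raagGen Γ y) ∈
      Subgroup.closure (raagGen Γ '' (T.S ∪ {x})) := by
  have hy' : raagGen Γ y ∈ Subgroup.closure (raagGen Γ '' (T.S ∪ {x})) :=
    Subgroup.subset_closure ⟨y, hy, rfl⟩
  have ht : raagGen Γ (T.t i) ∈ Subgroup.closure (raagGen Γ '' (T.S ∪ {x})) :=
    Subgroup.subset_closure ⟨_, Or.inl (T.t_mem i), rfl⟩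
  by_cases hyD : y ∈ T.D i
  · rw [twistHom_gen_mem _ _ hyD]
    exact mul_mem (mul_mem (zpow_mem ht _) hy') (zpow_mem ht _)
  · rwa [twistHom_gen_not_mem _ _ hyD]

open Classical in
theorem sum_conj_eq {u x : V} (hu : u ∈ T.S) (hux : ¬ Γ.Adj u x) (hne : u ≠ x)
    (hsep : ∀ j, T.t j = x → u ∉ T.D j) {f : I →₀ ℤ} {g : RAAG Γ}
    (hfg : ∀ b, T.toAut (Multiplicative.ofAdd f) b = g * b * g⁻¹) :
    (∑ j, if T.t j = u ∧ x ∈ T.D j then f j * T.ε j else 0) =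
      Multiplicative.toAdd (raagExp Γ u g) := by
  have key := T.toAut_induced (raagPair Γ hux) (pairEnd u x) (pairEnd_zero u x) (pairEnd_add hne)
    (T.S ∪ {x}) (fun j => if T.t j = u ∧ x ∈ T.D j then (1, -T.ε j) else 0) (by
      intro i n y hy
      refine ⟨T.twistHom_mem_closure i n hy, ?_⟩
      by_cases hyD : y ∈ T.D i
      · rw [twistHom_gen_mem _ _ hyD]
        simp only [map_mul, map_zpow]
        by_cases hyx : y = x
        · subst hyx
          rw [raagPair_right, pairEnd_self]
          by_cases htu : T.t i = u
          · rw [htu, raagPair_left]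
            simp [hyD, mul_comm]
          · have hty : T.t i ≠ y := fun h => (T.isTwist i).not_mem (h ▸ hyD)
            rw [raagPair_of_ne _ _ htu hty]
            simp [htu]
        · have hyS : y ∈ T.S := hy.resolve_right hyx
          have hε : T.ε i = 1 := (T.isTwist i).type.resolve_right
            fun h => T.disjoint i h.1 y hyD hyS
          rw [hε, one_mul, zpow_neg]
          by_cases hyu : y = u
          · subst hyu
            have hty : T.t i ≠ y := fun h => (T.isTwist i).not_mem (h ▸ hyD)
            have htx : T.t i ≠ x := fun h => hsep i h hyD
            rw [raagPair_of_ne _ _ hty htx, raagPair_left, pairEnd_of_ne hyx]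
            simp
          · rw [raagPair_of_ne _ _ hyu hyx]
            simp
      · rw [twistHom_gen_not_mem _ _ hyD]
        by_cases hyx : y = x
        · subst hyx
          simp [hyD, pairEnd_zero]
        · by_cases hyu : y = u
          · subst hyu
            rw [raagPair_left, pairEnd_of_ne hyx]
          · rw [raagPair_of_ne _ _ hyu hyx, map_one]) f
  have hu' := (key (raagGen Γ u) (Subgroup.subset_closure ⟨u, Or.inl hu, rfl⟩)).2
  have hx' := (key (raagGen Γ x) (Subgroup.subset_closure ⟨x, Or.inr rfl, rfl⟩)).2
  rw [hfg, map_mul, map_mul, map_inv, raagPair_left, pairEnd_of_ne hne] at hu'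
  have hcomm : Commute (FreeGroup.of u) (raagPair Γ hux g) :=
    (mul_inv_eq_iff_eq_mul.mp hu').symm
  rw [hfg, map_mul, map_mul, map_inv, raagPair_right, pairEnd_self,
    raagPair_eq_zpow_of_commute Γ hux hcomm] at hx'
  have hq := FreeGroup.eq_neg_of_conj_eq hne hx'
  rw [Prod.snd_sum] at hq
  have hq' := congrArg Neg.neg hq
  rw [neg_neg, ← Finset.sum_neg_distrib] at hq'
  rw [← hq']
  refine Finset.sum_congr rfl fun j _ => ?_
  split_ifs <;> simp

open Classical in
theorem sum_left_eq_zero {u w : V} (hw : w ∉ T.S) {f : I →₀ ℤ} {g : RAAG Γ}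
    (hfg : ∀ b, T.toAut (Multiplicative.ofAdd f) b = g * b * g⁻¹) :
    (∑ j, if T.t j = u ∧ w ∈ T.D j then f j * (1 - T.ε j) else 0) = 0 := by
  have key := T.toAut_induced ((raagExp Γ w).prod (raagExp Γ u)) shearEnd
    (by ext <;> simp [shearEnd_apply])
    (fun a b => MonoidHom.ext fun x => by
      simp only [shearEnd_apply, MonoidHom.comp_apply, zpow_add]
      rw [mul_comm (x.1 ^ a), mul_assoc])
    (T.S ∪ {w}) (fun j => if T.t j = u ∧ w ∈ T.D j then 1 - T.ε j else 0) (by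
      intro i n y hy
      refine ⟨T.twistHom_mem_closure i n hy, ?_⟩
      have htw : raagExp Γ w (raagGen Γ (T.t i)) = 1 :=
        raagExp_of_ne Γ fun h => hw (h ▸ T.t_mem i)
      rw [shearEnd_apply]
      by_cases hyw : y = w
      · subst hyw
        by_cases hyD : y ∈ T.D i
        · rw [twistHom_gen_mem _ _ hyD]
          simp only [map_mul, map_zpow, MonoidHom.prod_apply, htw, raagExp_self]
          by_cases htu : T.t i = u
          · subst htu
            rw [raagExp_self, mul_right_comm, mul_comm, ← zpow_add]
            simp only [hyD, and_self, if_true, smul_eq_mul]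
            refine Prod.ext (by simp) ?_
            simp only [Prod.snd_mul, Prod.pow_snd]
            refine congrArg _ (congrArg _ ?_)
            ring
          · rw [raagExp_of_ne Γ htu]
            simp [htu]
        · rw [twistHom_gen_not_mem _ _ hyD]
          simp [hyD]
      · have hyS : y ∈ T.S := hy.resolve_right hyw
        by_cases hyD : y ∈ T.D i
        · have hε : T.ε i = 1 := (T.isTwist i).type.resolve_right
            fun h => T.disjoint i h.1 y hyD hyS
          rw [twistHom_gen_mem _ _ hyD, hε, one_mul, zpow_neg]
          simp [raagExp_of_ne Γ hyw]
        · rw [twistHom_gen_not_mem _ _ hyD]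
          simp [raagExp_of_ne Γ hyw]) f
  have hw' := (key (raagGen Γ w) (Subgroup.subset_closure ⟨w, Or.inr rfl, rfl⟩)).2
  rw [hfg, shearEnd_apply] at hw'
  have h2 := congrArg Prod.snd hw'
  simp only [map_mul, map_inv, MonoidHom.prod_apply, raagExp_self] at h2
  rw [Prod.snd_mul, Prod.snd_mul, Prod.snd_inv, mul_inv_cancel_comm, left_eq_mul] at h2
  have h3 := congrArg Multiplicative.toAdd h2
  simp only [toAdd_zpow, toAdd_ofAdd, toAdd_one, smul_eq_mul, mul_one] at h3
  refine Eq.trans (Finset.sum_congr rfl fun j _ => ?_) h3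
  split_ifs <;> simp

theorem injective_outMk_comp_toAut {r s xr xs : V} (hrS : r ∈ T.S) (hsS : s ∈ T.S)
    (hr : ∀ i, r ∉ T.D i) (hs : ∀ i, s ∉ T.D i)
    (htri : ∀ u, ¬ (Γ.Adj r u ∧ Γ.Adj s u))
    (hrx : ¬ Γ.Adj r xr) (hrne : r ≠ xr) (hxr : ∀ i, T.ε i = 1 → T.t i = r → xr ∉ T.D i)
    (hsx : ¬ Γ.Adj s xs) (hsne : s ≠ xs) (hxs : ∀ i, T.ε i = 1 → T.t i = s → xs ∉ T.D i)
    (hconj : ∀ i, T.ε i = 1 → ∃ x ∈ T.D i, ¬ Γ.Adj (T.t i) x ∧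
      (∀ j, T.t j = x → T.t i ∉ T.D j) ∧
      ∀ j, j ≠ i → T.ε j = 1 → T.t j = T.t i → x ∉ T.D j)
    (hleft : ∀ i, T.ε i = 0 → ∃ w ∈ T.D i, ∀ j, j ≠ i → T.ε j = 0 → T.t j = T.t i → w ∉ T.D j) :
    Function.Injective ((outMk (RAAG Γ)).comp T.toAut) := by
  classical
  rw [injective_iff_map_eq_one]
  intro f hf
  obtain ⟨f, rfl⟩ := Multiplicative.ofAdd.surjective f
  rw [MonoidHom.comp_apply, outMk, QuotientGroup.mk'_apply, QuotientGroup.eq_one_iff] at hf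
  obtain ⟨g, hg⟩ := hf
  have hfg : ∀ b, T.toAut (Multiplicative.ofAdd f) b = g * b * g⁻¹ := fun b => by
    rw [← hg, MulAut.conj_apply]
  have hcomm : ∀ y, (∀ i, y ∉ T.D i) → Commute (raagGen Γ y) g := fun y hy => by
    have h1 := T.toAut_gen_of_fixed hy f
    rw [hfg] at h1
    exact (mul_inv_eq_iff_eq_mul.mp h1).symm
  have hroot : ∀ y x, y ∈ T.S → (∀ i, y ∉ T.D i) → ¬ Γ.Adj y x → y ≠ x →
      (∀ i, T.ε i = 1 → T.t i = y → x ∉ T.D i) → raagExp Γ y g = 1 := by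
    intro y x hyS hy hyx hne hx
    have h1 := T.sum_conj_eq hyS hyx hne (fun j _ => hy j) hfg
    rw [Finset.sum_eq_zero] at h1
    · exact (Multiplicative.toAdd.injective h1).symm
    · intro j _
      split_ifs with h
      · rcases (T.isTwist j).type with h2 | ⟨h2, _⟩
        · exact absurd h.2 (hx j h2 h.1)
        · rw [h2, mul_zero]
      · rfl
  have hexp : ∀ u, raagExp Γ u g = 1 := by
    intro u
    by_cases hur : r = u
    · subst hur; exact hroot r xr hrS hr hrx hrne hxr
    by_cases hus : s = u
    · subst hus; exact hroot s xs hsS hs hsx hsne hxs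
    by_cases hadj : Γ.Adj r u
    · exact raagExp_eq_one_of_commute Γ (fun h => htri u ⟨hadj, h⟩) hus (hcomm s hs)
    · exact raagExp_eq_one_of_commute Γ hadj hur (hcomm r hr)
  have hzero : f = 0 := by
    ext i
    rcases (T.isTwist i).type with hi | ⟨hi, -⟩
    · obtain ⟨x, hxD, hadj, hsep, hx⟩ := hconj i hi
      have hne : T.t i ≠ x := fun h => (T.isTwist i).not_mem (h ▸ hxD)
      have h1 := T.sum_conj_eq (T.t_mem i) hadj hne hsep hfg
      rw [hexp, toAdd_one, Finset.sum_eq_single i] at h1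
      · simpa [hxD, hi] using h1
      · intro j _ hj
        split_ifs with h
        · rcases (T.isTwist j).type with h2 | ⟨h2, _⟩
          · exact absurd h.2 (hx j hj h2 h.1)
          · rw [h2, mul_zero]
        · rfl
      · simp
    · obtain ⟨w, hwD, hw⟩ := hleft i hi
      have h1 := T.sum_left_eq_zero (u := T.t i) (T.disjoint i hi w hwD) hfg
      rw [Finset.sum_eq_single i] at h1
      · simpa [hwD, hi] using h1
      · intro j _ hj
        split_ifs with h
        · rcases (T.isTwist j).type with h2 | ⟨h2, _⟩
          · rw [h2, sub_self, mul_zero]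
          · exact absurd h.2 (hw j hj h2 h.1)
        · rfl
      · simp
  rw [hzero, ofAdd_zero]

end TwistFamily

end RAAG

section Branches

variable {V : Type*} {Γ : SimpleGraph V}

theorem ReachAvoid.refl {u x : V} (h : x ≠ u) : ReachAvoid Γ u x x :=
  ⟨.nil, by simpa using h.symm⟩

theorem ReachAvoid.symm {u x y : V} (h : ReachAvoid Γ u x y) : ReachAvoid Γ u y x := by
  obtain ⟨p, hp⟩ := h
  exact ⟨p.reverse, by simpa using hp⟩

theorem ReachAvoid.trans {u x y z : V} (h : ReachAvoid Γ u x y) (h' : ReachAvoid Γ u y z) :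
    ReachAvoid Γ u x z := by
  obtain ⟨p, hp⟩ := h
  obtain ⟨q, hq⟩ := h'
  exact ⟨p.append q, by simp [SimpleGraph.Walk.mem_support_append_iff, hp, hq]⟩

theorem ReachAvoid.ne_right {u x y : V} (h : ReachAvoid Γ u x y) : y ≠ u := by
  obtain ⟨p, hp⟩ := h
  rintro rfl
  exact hp p.end_mem_support

theorem ReachAvoid.of_adj {u x y : V} (h : Γ.Adj x y) (hx : x ≠ u) (hy : y ≠ u) :
    ReachAvoid Γ u x y :=
  ⟨.cons h .nil, by simp [hx.symm, hy.symm]⟩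

/-- A set meeting a walk and closed under adjacency along the walk contains its endpoint. -/
theorem SimpleGraph.Walk.mem_of_closed {X : Set V} {x y : V} (p : Γ.Walk x y) (hx : x ∈ X)
    (hX : ∀ a ∈ X, ∀ b ∈ p.support, Γ.Adj a b → b ∈ X) : y ∈ X := by
  induction p with
  | nil => exact hx
  | cons h p ih =>
    refine ih (hX _ hx _ (by simp) h) fun a ha b hb hab => hX a ha b ?_ hab
    simp [hb]

theorem SimpleGraph.Connected.mem_of_closed (hconn : Γ.Connected) {X : Set V} {x : V} (hx : x ∈ X)
    (hX : ∀ a ∈ X, ∀ b, Γ.Adj a b → b ∈ X) (y : V) : y ∈ X := by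
  obtain ⟨p⟩ := hconn.preconnected x y
  exact p.mem_of_closed hx fun a ha b _ hab => hX a ha b hab

/-- `C` is a connected component of `Γ ∖ {u}`. -/
def IsBranch (Γ : SimpleGraph V) (u : V) (C : Set V) : Prop :=
  ∃ x, x ≠ u ∧ C = {y | ReachAvoid Γ u x y}

theorem isBranch_reachAvoid {u x : V} (h : x ≠ u) : IsBranch Γ u {y | ReachAvoid Γ u x y} :=
  ⟨x, h, rfl⟩

namespace IsBranch

variable {u v : V} {C D : Set V}

theorem not_mem (h : IsBranch Γ u C) : u ∉ C := by
  obtain ⟨x, -, rfl⟩ := h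
  exact fun h => h.ne_right rfl

theorem ne_of_mem (h : IsBranch Γ u C) {y : V} (hy : y ∈ C) : y ≠ u :=
  fun e => h.not_mem (e ▸ hy)

theorem nonempty (h : IsBranch Γ u C) : C.Nonempty := by
  obtain ⟨x, hx, rfl⟩ := h
  exact ⟨x, .refl hx⟩

theorem mem_of_adj (h : IsBranch Γ u C) {y z : V} (hy : y ∈ C) (hyz : Γ.Adj y z) (hz : z ≠ u) :
    z ∈ C := by
  have hyu := h.ne_of_mem hy
  obtain ⟨x, hx, rfl⟩ := h
  exact ReachAvoid.trans hy (.of_adj hyz hyu hz)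

theorem reachAvoid (h : IsBranch Γ u C) {y z : V} (hy : y ∈ C) (hz : z ∈ C) :
    ReachAvoid Γ u y z := by
  obtain ⟨x, hx, rfl⟩ := h
  exact hy.symm.trans hz

theorem mem_of_reachAvoid (h : IsBranch Γ u C) {y z : V} (hy : y ∈ C) (hz : ReachAvoid Γ u y z) :
    z ∈ C := by
  obtain ⟨x, hx, rfl⟩ := h
  exact ReachAvoid.trans hy hz

theorem eq_of_mem (h : IsBranch Γ u C) (h' : IsBranch Γ u D) {y : V} (hy : y ∈ C) (hy' : y ∈ D) :
    C = D := by
  ext z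
  exact ⟨fun hz => h'.mem_of_reachAvoid hy' (h.reachAvoid hy hz),
    fun hz => h.mem_of_reachAvoid hy (h'.reachAvoid hy' hz)⟩

theorem subset_of_closed (h : IsBranch Γ u C) {X : Set V} {y : V} (hy : y ∈ C) (hyX : y ∈ X)
    (hX : ∀ a ∈ X, ∀ b ∈ C, Γ.Adj a b → b ∈ X) : C ⊆ X := by
  classical
  intro z hz
  obtain ⟨p, hp⟩ := h.reachAvoid hy hz
  refine p.mem_of_closed hyX fun a ha b hb hab => hX a ha b ?_ hab
  refine h.mem_of_reachAvoid hy ⟨p.takeUntil b hb, fun hu => hp ?_⟩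
  exact p.support_takeUntil_subset_support hb hu

theorem exists_adj (h : IsBranch Γ u C) (hconn : Γ.Connected) : ∃ y ∈ C, Γ.Adj u y := by
  by_contra! hcon
  obtain ⟨y, hy⟩ := h.nonempty
  refine h.not_mem (hconn.mem_of_closed hy (fun a ha b hab => ?_) u)
  refine h.mem_of_adj ha hab ?_
  rintro rfl
  exact hcon a ha hab.symm

theorem eq_singleton (h : IsBranch Γ u C) {w : V} (hw : w ∈ C)
    (hw' : ∀ z, Γ.Adj w z → z = u) : C = {w} := by
  refine Set.Subset.antisymm (h.subset_of_closed hw rfl ?_) (by simpa using hw)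
  rintro a rfl b hb hab
  exact absurd (hw' b hab) (h.ne_of_mem hb)

theorem exists_mem_adj (h : IsBranch Γ u C) (hC : ∀ w, C ≠ {w}) {w : V} (hw : w ∈ C) :
    ∃ z ∈ C, Γ.Adj w z := by
  by_contra! hcon
  refine hC w (h.eq_singleton hw fun z hz => ?_)
  by_contra hzu
  exact hcon z (h.mem_of_adj hw hz hzu) hz

theorem disjoint (h : IsBranch Γ u C) (h' : IsBranch Γ v D) (hconn : Γ.Connected)
    (huv : u ≠ v) (hv : v ∉ C) (hu : u ∉ D) : Disjoint C D := by
  rw [Set.disjoint_left]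
  intro y hy hy'
  have hDC : D ⊆ C := h'.subset_of_closed hy' hy fun a ha b hb hab =>
    h.mem_of_adj ha hab fun e => hu (e ▸ hb)
  have hCD : C ⊆ D := h.subset_of_closed hy hy' fun a ha b hb hab =>
    h'.mem_of_adj ha hab fun e => hv (e ▸ hb)
  obtain ⟨z, hz, hzu⟩ := h.exists_adj hconn
  exact hu (h'.mem_of_adj (hCD hz) hzu.symm huv)

theorem subset_of_mem (h : IsBranch Γ u C) (h' : IsBranch Γ v D) (hconn : Γ.Connected)
    (hv : v ∈ C) (hu : u ∉ D) : D ⊆ C := by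
  obtain ⟨y, hy, hvy⟩ := h'.exists_adj hconn
  have hyC : y ∈ C := h.mem_of_adj hv hvy fun e => hu (e ▸ hy)
  exact h'.subset_of_closed hy hyC fun a ha b hb hab =>
    h.mem_of_adj ha hab fun e => hu (e ▸ hb)

theorem not_mem_of_mem (h : IsBranch Γ u C) (h' : IsBranch Γ v D) (hconn : Γ.Connected)
    {r : V} (hr : r ∉ C) (hr' : r ∉ D) (hv : v ∈ C) : u ∉ D := by
  intro hu
  have : r ∈ C ∪ D := by
    refine hconn.mem_of_closed (Or.inl hv) ?_ r
    rintro a (ha | ha) b hab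
    · by_cases hb : b = u
      · exact Or.inr (hb ▸ hu)
      · exact Or.inl (h.mem_of_adj ha hab hb)
    · by_cases hb : b = v
      · exact Or.inl (hb ▸ hv)
      · exact Or.inr (h'.mem_of_adj ha hab hb)
  exact this.elim hr hr'

end IsBranch

/-- A branch at `u` containing neither of the vertices `r` and `s`. -/
structure IsFreeBranch (Γ : SimpleGraph V) (r s u : V) (C : Set V) : Prop where
  isBranch : IsBranch Γ u C
  left_not_mem : r ∉ C
  right_not_mem : s ∉ C

/-- Choices made in the construction of commuting twists: a set `S` of representatives of the
maximal vertices, an edge of `S`, a multiplier `m u` for the branches at `u`, and a multiplier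
`f w` for each vertex `w` outside `S`. -/
structure TwistData (Γ : SimpleGraph V) (S : Set V) (r s : V) (m f : V → V) : Prop where
  conn : Γ.Connected
  tri : ∀ a b c, Γ.Adj a b → Γ.Adj b c → ¬ Γ.Adj a c
  exists_subset : ∀ v, ∃ w ∈ S, Γ.neighborSet v ⊆ Γ.neighborSet w
  exists_adj_ne : ∀ v ∈ S, ∀ u, ∃ z, z ≠ u ∧ Γ.Adj v z
  left_mem : r ∈ S
  right_mem : s ∈ S
  adj : Γ.Adj r s
  m_mem : ∀ u, m u ∈ S
  m_adj : ∀ u, Γ.Adj u (m u)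
  m_not_mem : ∀ u C, IsFreeBranch Γ r s u C → m u ∉ C
  f_mem : ∀ w, f w ∈ S
  f_adj : ∀ w z, Γ.Adj w z → Γ.Adj (f w) z
  f_eq : ∀ w u, w ∉ S → (∀ z, Γ.Adj w z → z = u) → f w = m u

/-- The twists used in the lower bound. -/
inductive IsBasicTwist (Γ : SimpleGraph V) (S : Set V) (r s : V) (m f : V → V) :
    V → Set V → ℤ → Prop
  | fold (w : V) (ε : ℤ) (hw : w ∉ S) (hε : ε = 0 ∨ ε = 1) :
      IsBasicTwist Γ S r s m f (f w) {w} ε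
  | leaf (u w : V) (h : IsFreeBranch Γ r s u {w}) : IsBasicTwist Γ S r s m f u {w} 0
  | branch (u : V) (C : Set V) (h : IsFreeBranch Γ r s u C) (hC : ∀ w, C ≠ {w}) :
      IsBasicTwist Γ S r s m f (m u) C 1

theorem IsFreeBranch.eq_of_neighborSet_subset {r s u v : V} {C : Set V}
    (h : IsFreeBranch Γ r s u C) (hconn : Γ.Connected) (hrs : r ≠ s)
    (huv : Γ.neighborSet u ⊆ Γ.neighborSet v) : v = u := by
  by_contra hne
  obtain ⟨ρ, hρu, hρ⟩ : ∃ ρ, ρ ≠ u ∧ ρ ∉ C := by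
    by_cases hr : r = u
    · exact ⟨s, fun h => hrs (hr.trans h.symm), h.right_not_mem⟩
    · exact ⟨r, hr, h.left_not_mem⟩
  have hE := isBranch_reachAvoid (Γ := Γ) hρu
  obtain ⟨y, hy, huy⟩ := hE.exists_adj hconn
  obtain ⟨x, hx, hux⟩ := h.isBranch.exists_adj hconn
  have hvE := hE.mem_of_adj hy (huv huy).symm hne
  have hvC := h.isBranch.mem_of_adj hx (huv hux).symm hne
  have := h.isBranch.eq_of_mem hE hvC hvE
  exact hρ (this ▸ ReachAvoid.refl hρu)

theorem IsFreeBranch.adj_iff_of_singleton {r s u w : V} (h : IsFreeBranch Γ r s u {w})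
    (hconn : Γ.Connected) (z : V) : Γ.Adj w z ↔ z = u := by
  obtain ⟨y, rfl, huy⟩ := h.isBranch.exists_adj hconn
  refine ⟨fun hz => ?_, fun e => e ▸ huy.symm⟩
  by_contra hne
  have : z = y := h.isBranch.mem_of_adj rfl hz hne
  exact Γ.irrefl (this ▸ hz)

namespace TwistData

variable {S : Set V} {r s : V} {m f : V → V} (T : TwistData Γ S r s m f)
include T

theorem mem_of_isFreeBranch {u : V} {C : Set V} (h : IsFreeBranch Γ r s u C) : u ∈ S := by
  obtain ⟨w, hw, huw⟩ := T.exists_subset u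
  rwa [h.eq_of_neighborSet_subset T.conn T.adj.ne huw] at hw

theorem not_mem_of_isFreeBranch_singleton {u w : V} (h : IsFreeBranch Γ r s u {w}) : w ∉ S := by
  intro hw
  obtain ⟨z, hz, hwz⟩ := T.exists_adj_ne w hw u
  exact hz ((h.adj_iff_of_singleton T.conn z).mp hwz)

theorem mult_mem {t : V} {D : Set V} {ε : ℤ} (h : IsBasicTwist Γ S r s m f t D ε) : t ∈ S := by
  cases h with
  | fold w _ hw hε => exact T.f_mem w
  | leaf _ w h => exact T.mem_of_isFreeBranch h
  | branch u _ h hC => exact T.m_mem u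

theorem root_not_mem {t : V} {D : Set V} {ε : ℤ} (h : IsBasicTwist Γ S r s m f t D ε) :
    r ∉ D ∧ s ∉ D := by
  cases h with
  | fold w _ hw hε =>
    exact ⟨fun e => hw (e ▸ T.left_mem), fun e => hw (e ▸ T.right_mem)⟩
  | leaf _ w h => exact ⟨h.left_not_mem, h.right_not_mem⟩
  | branch u _ h hC => exact ⟨h.left_not_mem, h.right_not_mem⟩

theorem not_mem_of_eq_zero {t : V} {D : Set V} {ε : ℤ} (h : IsBasicTwist Γ S r s m f t D ε)
    (hε : ε = 0) {y : V} (hy : y ∈ D) : y ∉ S := by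
  cases h with
  | fold w _ hw _ => exact hy ▸ hw
  | leaf _ w h => exact hy ▸ T.not_mem_of_isFreeBranch_singleton h
  | branch u _ h hC => exact absurd hε one_ne_zero

theorem isTwist {t : V} {D : Set V} {ε : ℤ} (h : IsBasicTwist Γ S r s m f t D ε) :
    IsTwist Γ t D ε := by
  cases h with
  | fold w _ hw hε =>
    refine ⟨fun e => hw (e ▸ T.f_mem w), ?_, hε.symm.imp_right fun e => ⟨e, w, rfl⟩⟩
    rintro y rfl z hz -
    exact Or.inr (T.f_adj y z hz)
  | leaf _ w h =>
    refine ⟨h.isBranch.not_mem, ?_, Or.inr ⟨rfl, w, rfl⟩⟩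
    rintro y rfl z hz -
    exact Or.inl ((h.adj_iff_of_singleton T.conn z).mp hz)
  | branch u _ h hC =>
    refine ⟨T.m_not_mem u _ h, fun y hy z hyz hz => Or.inr ?_, Or.inl rfl⟩
    have : z = u := by
      by_contra hzu
      exact hz (h.isBranch.mem_of_adj hy hyz hzu)
    exact this ▸ (T.m_adj u).symm

theorem m_ne (u : V) : m u ≠ u := (T.m_adj u).ne'

theorem f_mem_branch {u w : V} {C : Set V} (h : IsFreeBranch Γ r s u C) (hC : ∀ w, C ≠ {w})
    (hw : w ∈ C) (hne : f w ≠ u) : f w ∈ C := by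
  obtain ⟨z, hz, hwz⟩ := h.isBranch.exists_mem_adj hC hw
  exact h.isBranch.mem_of_adj hz (T.f_adj w z hwz).symm hne

theorem mem_branch_of_f {u w : V} {C : Set V} (h : IsFreeBranch Γ r s u C) (hwS : w ∉ S)
    (hfw : f w ∈ C) : w ∈ C := by
  have hw : ∃ z, Γ.Adj w z ∧ z ≠ u := by
    by_contra! hcon
    exact T.m_not_mem u C h (T.f_eq w u hwS hcon ▸ hfw)
  obtain ⟨z, hwz, hzu⟩ := hw
  have hzC := h.isBranch.mem_of_adj hfw (T.f_adj w z hwz) hzu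
  refine h.isBranch.mem_of_adj hzC hwz.symm ?_
  rintro rfl
  exact hwS (T.mem_of_isFreeBranch h)

theorem commute_singleton {t t' w w' : V} {ε ε' : ℤ}
    (h : IsBasicTwist Γ S r s m f t {w} ε) (h' : IsBasicTwist Γ S r s m f t' {w'} ε')
    (hw : w ∉ S) (hw' : w' ∉ S) (hadj : w = w' → t = t' ∨ Γ.Adj t t') :
    TwistsCommute Γ t {w} ε t' {w'} := by
  refine Or.inl ⟨fun e => hw' (e ▸ T.mult_mem h), fun e => hw (e ▸ T.mult_mem h'), ?_⟩
  by_cases hww : w = w'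
  · exact (hadj hww).imp_right Or.inr
  · exact Or.inr (Or.inl (by simpa using hww))

theorem commute_branch {u t : V} {C D : Set V}
    (hm : m u ∉ D) (hsub : t ∈ C → D ⊆ C) (hdis : t ∉ C → t ≠ m u → t ≠ u → Disjoint C D) :
    TwistsCommute Γ (m u) C 1 t D := by
  by_cases ht : t ∈ C
  · exact Or.inr ⟨ht, hm, hsub ht, rfl⟩
  · refine Or.inl ⟨hm, ht, ?_⟩
    by_cases htm : t = m u
    · exact Or.inl htm.symm
    by_cases htu : t = u
    · exact Or.inr (Or.inr (htu ▸ (T.m_adj u).symm))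
    · exact Or.inr (Or.inl (hdis ht htm htu))

theorem commute_branch_fold {u w : V} {C : Set V} (h : IsFreeBranch Γ r s u C)
    (hC : ∀ w, C ≠ {w}) (hw : w ∉ S) :
    TwistsCommute Γ (m u) C 1 (f w) {w} := by
  refine T.commute_branch (fun e => hw (e ▸ T.m_mem u)) ?_ ?_
  · rintro ht _ rfl
    exact T.mem_branch_of_f h hw ht
  · intro ht _ htu
    rw [Set.disjoint_singleton_right]
    exact fun hwC => ht (T.f_mem_branch h hC hwC htu)

theorem commute_branch_leaf {u v w : V} {C : Set V} (h : IsFreeBranch Γ r s u C)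
    (h' : IsFreeBranch Γ r s v {w}) :
    TwistsCommute Γ (m u) C 1 v {w} := by
  have hw := T.not_mem_of_isFreeBranch_singleton h'
  refine T.commute_branch (fun e => hw (e ▸ T.m_mem u)) ?_ ?_
  · intro hv
    exact h.isBranch.subset_of_mem h'.isBranch T.conn hv
      (h.isBranch.not_mem_of_mem h'.isBranch T.conn h.left_not_mem h'.left_not_mem hv)
  · intro hv _ hvu
    exact h.isBranch.disjoint h'.isBranch T.conn hvu.symm hv
      fun e => hw (e ▸ T.mem_of_isFreeBranch h)

theorem m_mem_branch {u v : V} {C : Set V} (h : IsFreeBranch Γ r s u C) (hv : v ∈ C)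
    (hne : m v ≠ u) : m v ∈ C :=
  h.isBranch.mem_of_adj hv (T.m_adj v) hne

theorem commute_branch_branch {u v : V} {C D : Set V} (h : IsFreeBranch Γ r s u C)
    (h' : IsFreeBranch Γ r s v D) (hu : u ∉ D) : TwistsCommute Γ (m u) C 1 (m v) D := by
  have hsub : v ∈ C → D ⊆ C := fun hv => h.isBranch.subset_of_mem h'.isBranch T.conn hv hu
  have hdis : v ∉ C → u ≠ v → Disjoint C D := fun hv huv =>
    h.isBranch.disjoint h'.isBranch T.conn huv hv hu
  refine T.commute_branch ?_ ?_ ?_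
  · intro hm
    by_cases huv : u = v
    · subst huv
      exact T.m_not_mem u D h' hm
    · exact hu (h'.isBranch.mem_of_adj hm (T.m_adj u).symm huv)
  · intro hm
    refine hsub (h.isBranch.mem_of_adj hm (T.m_adj v).symm ?_)
    rintro rfl
    exact T.m_not_mem v C h hm
  · intro hm hne hne'
    refine hdis (fun hv => hm (T.m_mem_branch h hv hne')) ?_
    rintro rfl
    exact hne rfl

theorem commute {t t' : V} {D D' : Set V} {ε ε' : ℤ} (h : IsBasicTwist Γ S r s m f t D ε)
    (h' : IsBasicTwist Γ S r s m f t' D' ε') :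
    TwistsCommute Γ t D ε t' D' ∨ TwistsCommute Γ t' D' ε' t D := by
  have hleaf : ∀ {u w}, IsFreeBranch Γ r s u {w} → Γ.Adj (f w) u := fun hb =>
    T.f_adj _ _ ((hb.adj_iff_of_singleton T.conn _).mpr rfl)
  cases h with
  | fold w _ hw hε =>
    cases h' with
    | fold w' _ hw' hε' =>
      exact Or.inl (T.commute_singleton (.fold w ε hw hε) (.fold w' ε' hw' hε') hw hw'
        fun e => Or.inl (e ▸ rfl))
    | leaf _ w' hb =>
      exact Or.inl (T.commute_singleton (.fold w ε hw hε) (.leaf _ w' hb) hw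
        (T.not_mem_of_isFreeBranch_singleton hb) fun e => Or.inr (e ▸ hleaf hb))
    | branch u _ hb hC => exact Or.inr (T.commute_branch_fold hb hC hw)
  | leaf _ w hb =>
    have hw := T.not_mem_of_isFreeBranch_singleton hb
    cases h' with
    | fold w' _ hw' hε' =>
      exact Or.inl (T.commute_singleton (.leaf _ w hb) (.fold w' ε' hw' hε') hw hw'
        fun e => Or.inr (e ▸ hleaf hb).symm)
    | leaf _ w' hb' =>
      refine Or.inl (T.commute_singleton (.leaf _ w hb) (.leaf _ w' hb') hw
        (T.not_mem_of_isFreeBranch_singleton hb') ?_)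
      rintro rfl
      exact Or.inl ((hb'.adj_iff_of_singleton T.conn _).mp
        ((hb.adj_iff_of_singleton T.conn _).mpr rfl))
    | branch u _ hb' hC => exact Or.inr (T.commute_branch_leaf hb' hb)
  | branch u _ hb hC =>
    cases h' with
    | fold w' _ hw' hε' => exact Or.inl (T.commute_branch_fold hb hC hw')
    | leaf _ w' hb' => exact Or.inl (T.commute_branch_leaf hb hb')
    | branch v _ hb' hC' =>
      by_cases hu : u ∈ D'
      · exact Or.inr (T.commute_branch_branch hb' hb
          (hb'.isBranch.not_mem_of_mem hb.isBranch T.conn hb'.left_not_mem hb.left_not_mem hu))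
      · exact Or.inl (T.commute_branch_branch hb hb' hu)

/-- Two partial conjugations with the same multiplier have disjoint supports. -/
theorem eq_of_mem {t x : V} {D D' : Set V} (h : IsBasicTwist Γ S r s m f t D 1)
    (h' : IsBasicTwist Γ S r s m f t D' 1) (hx : x ∈ D) (hx' : x ∈ D') : D = D' := by
  have key : ∀ {u w C}, IsFreeBranch Γ r s u C → (∀ w, C ≠ {w}) → f w = m u → w ∉ C :=
    fun {u w C} hb hC hfm hw => T.m_not_mem u C hb
      (hfm ▸ T.f_mem_branch hb hC hw (hfm ▸ T.m_ne u))
  have key2 : ∀ {u v C D}, IsFreeBranch Γ r s u C → IsFreeBranch Γ r s v D → m u = m v →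
      v ∉ C := fun {u v C D} hb hb' hm hv => T.m_not_mem u C hb
        (hm ▸ T.m_mem_branch hb hv (hm ▸ T.m_ne u))
  generalize ht : t = t' at h'
  cases h with
  | fold w _ hw _ =>
    cases h' with
    | fold w' _ hw' _ => rw [← Set.mem_singleton_iff.mp hx, ← Set.mem_singleton_iff.mp hx']
    | branch u _ hb hC =>
      rw [Set.mem_singleton_iff.mp hx] at hx'
      exact absurd hx' (key hb hC ht)
  | branch u _ hb hC =>
    cases h' with
    | fold w' _ hw' _ =>
      rw [Set.mem_singleton_iff.mp hx'] at hx
      exact absurd hx (key hb hC ht.symm)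
    | branch v _ hb' hC' =>
      by_cases huv : u = v
      · subst huv
        exact hb.isBranch.eq_of_mem hb'.isBranch hx hx'
      · exact absurd hx' (Set.disjoint_left.mp (hb.isBranch.disjoint hb'.isBranch T.conn huv
          (key2 hb hb' ht) (key2 hb' hb ht.symm)) hx)

theorem not_mem_of_mult_mem {t t' : V} {D D' : Set V} {ε ε' : ℤ}
    (h : IsBasicTwist Γ S r s m f t D ε) (h' : IsBasicTwist Γ S r s m f t' D' ε')
    (ht' : t' ∈ D) : t ∉ D' := by
  rcases T.commute h h' with (h1 | h1) | (h1 | h1)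
  · exact h1.1
  · exact h1.2.1
  · exact h1.2.1
  · exact absurd ht' h1.2.1

/-- A partial conjugation moves a vertex by which it can be detected. -/
theorem exists_witness {t : V} {D : Set V} (h : IsBasicTwist Γ S r s m f t D 1) :
    ∃ x ∈ D, ¬ Γ.Adj t x := by
  cases h with
  | fold w _ hw _ =>
    obtain ⟨z, hz⟩ : ∃ z, Γ.Adj w z := by
      by_contra! hcon
      exact hw (T.conn.mem_of_closed (X := {w}) rfl (fun a ha b hab =>
        absurd hab (ha ▸ hcon b)) r ▸ T.left_mem)
    exact ⟨w, rfl, fun h => T.tri _ _ _ h hz (T.f_adj w z hz)⟩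
  | branch u _ hb hC =>
    obtain ⟨y, hy⟩ := hb.isBranch.nonempty
    refine ⟨y, hy, fun hadj => T.m_not_mem u D hb (hb.isBranch.mem_of_adj hy hadj.symm (T.m_ne u))⟩

end TwistData
end Branches

section Pieces

variable {V : Type*} {Γ : SimpleGraph V}

/-- `x` and `y` are joined by a walk inside `X`. -/
def JoinedWithin (Γ : SimpleGraph V) (X : Set V) (x y : V) : Prop :=
  ∃ p : Γ.Walk x y, ∀ z ∈ p.support, z ∈ X

namespace JoinedWithin

variable {X Y : Set V} {x y z : V}

theorem symm (h : JoinedWithin Γ X x y) : JoinedWithin Γ X y x := by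
  obtain ⟨p, hp⟩ := h
  exact ⟨p.reverse, by simpa using hp⟩

theorem trans (h : JoinedWithin Γ X x y) (h' : JoinedWithin Γ X y z) : JoinedWithin Γ X x z := by
  obtain ⟨p, hp⟩ := h
  obtain ⟨q, hq⟩ := h'
  refine ⟨p.append q, fun w hw => ?_⟩
  rcases SimpleGraph.Walk.mem_support_append_iff .. |>.mp hw with hw | hw
  · exact hp w hw
  · exact hq w hw

theorem mono (h : JoinedWithin Γ X x y) (hXY : X ⊆ Y) : JoinedWithin Γ Y x y := by
  obtain ⟨p, hp⟩ := h
  exact ⟨p, fun z hz => hXY (hp z hz)⟩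

end JoinedWithin

theorem SimpleGraph.Subgraph.Connected.joinedWithin {H : Γ.Subgraph} (h : H.Connected) {x y : V}
    (hx : x ∈ H.verts) (hy : y ∈ H.verts) : JoinedWithin Γ H.verts x y := by
  obtain ⟨p, hp⟩ := (H.connected_iff_forall_exists_walk_subgraph.mp h).2 hx hy
  exact ⟨p, fun z hz => hp.1 (p.mem_verts_toSubgraph.mpr hz)⟩

theorem connected_induce_of_joinedWithin {X : Set V} (hX : X.Nonempty)
    (h : ∀ x ∈ X, ∀ y ∈ X, JoinedWithin Γ X x y) :
    ((⊤ : Γ.Subgraph).induce X).Connected := by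
  rw [SimpleGraph.Subgraph.connected_iff_forall_exists_walk_subgraph]
  refine ⟨hX, fun {x y} hx hy => ?_⟩
  obtain ⟨p, hp⟩ := h x hx y hy
  exact ⟨p, p.toSubgraph_le_induce_support.trans (SimpleGraph.Subgraph.induce_mono_right hp)⟩

namespace IsPiece

variable {H H' : Γ.Subgraph}

theorem exists_ne (h : IsPiece Γ H) (w : V) : ∃ c ∈ H.verts, c ≠ w := by
  obtain ⟨e, he⟩ := h.2.1
  induction e with | _ a b =>
  have hab : H.Adj a b := he
  by_cases ha : a = w
  · exact ⟨b, H.edge_vert hab.symm, fun hb => hab.ne (ha.trans hb.symm)⟩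
  · exact ⟨a, H.edge_vert hab, ha⟩

theorem joinedWithin_diff (h : IsPiece Γ H) {w x y : V} (hx : x ∈ H.verts) (hy : y ∈ H.verts)
    (hxw : x ≠ w) (hyw : y ≠ w) : JoinedWithin Γ (H.verts \ {w}) x y := by
  by_cases hw : w ∈ H.verts
  · exact (h.2.2.1 w hw).joinedWithin ⟨hx, hxw⟩ ⟨hy, hyw⟩
  · rw [Set.sdiff_singleton_eq_self hw]
    exact h.1.joinedWithin hx hy

theorem reachAvoid (h : IsPiece Γ H) {w x y : V} (hx : x ∈ H.verts) (hy : y ∈ H.verts)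
    (hxw : x ≠ w) (hyw : y ≠ w) : ReachAvoid Γ w x y := by
  obtain ⟨p, hp⟩ := h.joinedWithin_diff hx hy hxw hyw
  exact ⟨p, fun hw => (hp w hw).2 rfl⟩

theorem eq_induce (h : IsPiece Γ H) {X : Set V} (hX : H.verts ⊆ X)
    (hdiff : ∀ w, ∀ x ∈ X, ∀ y ∈ X, x ≠ w → y ≠ w → JoinedWithin Γ (X \ {w}) x y)
    (hconn : ∀ x ∈ X, ∀ y ∈ X, JoinedWithin Γ X x y) :
    (⊤ : Γ.Subgraph).induce X = H := by
  have hle : H ≤ (⊤ : Γ.Subgraph).induce X :=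
    SimpleGraph.Subgraph.le_induce_top_verts.trans (SimpleGraph.Subgraph.induce_mono_right hX)
  refine h.2.2.2 _ (connected_induce_of_joinedWithin (h.1.nonempty.mono hX) hconn)
    (h.2.1.mono (SimpleGraph.Subgraph.edgeSet_mono hle)) (fun w hw => ?_) hle
  have : ((⊤ : Γ.Subgraph).induce X).deleteVerts {w} = (⊤ : Γ.Subgraph).induce (X \ {w}) := by
    ext a b
    · simp
    · simp; tauto
  rw [this]
  obtain ⟨c, hc, hcw⟩ := h.exists_ne w
  exact connected_induce_of_joinedWithin ⟨c, hX hc, hcw⟩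
    fun x hx y hy => hdiff w x hx.1 y hy.1 hx.2 hy.2

end IsPiece

theorem SimpleGraph.Walk.IsPath.joinedWithin_start_or_end {a b w z : V} {p : Γ.Walk a b}
    (hp : p.IsPath) (hz : z ∈ p.support) (hzw : z ≠ w) :
    JoinedWithin Γ ({y | y ∈ p.support} \ {w}) z a ∨
      JoinedWithin Γ ({y | y ∈ p.support} \ {w}) z b := by
  classical
  by_cases h : w ∈ (p.takeUntil z hz).support
  · right
    refine ⟨p.dropUntil z hz, fun y hy => ⟨p.support_dropUntil_subset_support hz hy, ?_⟩⟩
    rintro rfl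
    have hnodup := hp.support_nodup
    rw [← p.take_spec hz, SimpleGraph.Walk.support_append, List.nodup_append'] at hnodup
    refine hnodup.2.2 h ?_
    rw [← SimpleGraph.Walk.cons_tail_support, List.mem_cons] at hy
    exact hy.resolve_left hzw.symm
  · left
    refine JoinedWithin.symm ⟨p.takeUntil z hz, fun y hy =>
      ⟨p.support_takeUntil_subset_support hz hy, ?_⟩⟩
    rintro rfl
    exact h hy

namespace IsPiece

variable {H H' : Γ.Subgraph}

theorem induce_union_support_eq (h : IsPiece Γ H) (h' : IsPiece Γ H') {a b : V} {p : Γ.Walk a b}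
    (hp : p.IsPath) (ha : a ∈ H.verts) (hb : b ∈ H'.verts)
    (hlink : ∀ w, (∃ c ∈ H.verts, c ∈ H'.verts ∧ c ≠ w) ∨ w ∉ p.support) :
    (⊤ : Γ.Subgraph).induce (H.verts ∪ H'.verts ∪ {y | y ∈ p.support}) = H := by
  set X := H.verts ∪ H'.verts ∪ {y | y ∈ p.support}
  have hHX : H.verts ⊆ X := fun y hy => Or.inl (Or.inl hy)
  have hHX' : H'.verts ⊆ X := fun y hy => Or.inl (Or.inr hy)
  have hpX : {y | y ∈ p.support} ⊆ X := fun y hy => Or.inr hy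
  have hdiff : ∀ w, ∀ x ∈ X, ∀ y ∈ X, x ≠ w → y ≠ w → JoinedWithin Γ (X \ {w}) x y := by
    intro w
    obtain ⟨c, hc, hcw⟩ := h.exists_ne w
    have hH : ∀ x ∈ H.verts, x ≠ w → JoinedWithin Γ (X \ {w}) x c := fun x hx hxw =>
      (h.joinedWithin_diff hx hc hxw hcw).mono (Set.sdiff_subset_sdiff_left hHX)
    have hH' : ∀ x ∈ H'.verts, x ≠ w → JoinedWithin Γ (X \ {w}) x c := by
      intro x hx hxw
      rcases hlink w with ⟨d, hd, hd', hdw⟩ | hw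
      · exact ((h'.joinedWithin_diff hx hd' hxw hdw).mono (Set.sdiff_subset_sdiff_left hHX')).trans
          (hH d hd hdw)
      · have hbw : b ≠ w := fun e => hw (e ▸ p.end_mem_support)
        have haw : a ≠ w := fun e => hw (e ▸ p.start_mem_support)
        refine ((h'.joinedWithin_diff hx hb hxw hbw).mono
          (Set.sdiff_subset_sdiff_left hHX')).trans (JoinedWithin.trans ?_ (hH a ha haw))
        exact JoinedWithin.symm ⟨p, fun z hz => ⟨hpX hz, fun e => hw (e ▸ hz)⟩⟩
    have hend : ∀ {x y}, JoinedWithin Γ ({y | y ∈ p.support} \ {w}) x y → y ≠ w := by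
      rintro x y ⟨q, hq⟩
      exact (hq y q.end_mem_support).2
    have hX : ∀ x ∈ X, x ≠ w → JoinedWithin Γ (X \ {w}) x c := by
      rintro x ((hx | hx) | hx) hxw
      · exact hH x hx hxw
      · exact hH' x hx hxw
      · rcases hp.joinedWithin_start_or_end hx hxw with hj | hj
        · exact (hj.mono (Set.sdiff_subset_sdiff_left hpX)).trans (hH a ha (hend hj))
        · exact (hj.mono (Set.sdiff_subset_sdiff_left hpX)).trans (hH' b hb (hend hj))
    exact fun x hx y hy hxw hyw => (hX x hx hxw).trans (hX y hy hyw).symm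
  have hX : ∀ x ∈ X, JoinedWithin Γ X x a := by
    classical
    rintro x ((hx | hx) | hx)
    · exact (h.1.joinedWithin hx ha).mono hHX
    · exact ((h'.1.joinedWithin hx hb).mono hHX').trans
        (JoinedWithin.symm ⟨p, fun z hz => hpX hz⟩)
    · exact JoinedWithin.symm
        ⟨p.takeUntil x hx, fun z hz => hpX (p.support_takeUntil_subset_support hx hz)⟩
  exact h.eq_induce hHX hdiff fun x hx y hy => (hX x hx).trans (hX y hy).symm

theorem support_subset (h : IsPiece Γ H) {a b : V} {p : Γ.Walk a b} (hp : p.IsPath)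
    (ha : a ∈ H.verts) (hb : b ∈ H.verts) {y : V} (hy : y ∈ p.support) : y ∈ H.verts := by
  rw [← h.induce_union_support_eq h hp ha hb fun w => Or.inl ?_]
  · exact Or.inr hy
  · obtain ⟨c, hc, hcw⟩ := h.exists_ne w
    exact ⟨c, hc, hc, hcw⟩

theorem eq_of_reachAvoid (h : IsPiece Γ H) (h' : IsPiece Γ H') {v a b : V} (hv : v ∈ H.verts)
    (hv' : v ∈ H'.verts) (ha : a ∈ H.verts) (hb : b ∈ H'.verts) (hab : ReachAvoid Γ v a b) :
    H = H' := by
  classical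
  obtain ⟨p, hp⟩ := hab
  have hq : v ∉ p.bypass.support := fun e => hp (p.support_bypass_subset_support e)
  have hlink : ∀ w, (∃ c ∈ H.verts, c ∈ H'.verts ∧ c ≠ w) ∨ w ∉ p.bypass.support := by
    intro w
    by_cases hw : v = w
    · exact Or.inr (hw ▸ hq)
    · exact Or.inl ⟨v, hv, hv', hw⟩
  have hlink' : ∀ w, (∃ c ∈ H'.verts, c ∈ H.verts ∧ c ≠ w) ∨ w ∉ p.bypass.reverse.support :=
    fun w => (hlink w).imp (fun ⟨c, hc, hc', hcw⟩ => ⟨c, hc', hc, hcw⟩) (by simp)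
  refine (h.induce_union_support_eq h' p.bypass_isPath ha hb hlink).symm.trans (Eq.trans ?_
    (h'.induce_union_support_eq h p.bypass_isPath.reverse hb ha hlink'))
  rw [Set.union_comm H.verts]
  simp

/-- A piece not containing a given root `r` is attached to it at a vertex. -/
theorem exists_root (h : IsPiece Γ H) (hconn : Γ.Connected) (r : V) :
    ∃ v ∈ H.verts, ∃ C, IsBranch Γ v C ∧ (∀ y ∈ H.verts, y ≠ v → y ∈ C) ∧ (v ≠ r → r ∉ C) := by
  obtain ⟨v, hv, hmin⟩ : ∃ v ∈ H.verts, ∀ y ∈ H.verts, Γ.dist v r ≤ Γ.dist y r := by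
    have hne : ((fun v => Γ.dist v r) '' H.verts).Nonempty := h.1.nonempty.image _
    obtain ⟨v, hv, hve⟩ := Nat.sInf_mem hne
    exact ⟨v, hv, fun y hy => (le_of_eq hve).trans (Nat.sInf_le ⟨y, hy, rfl⟩)⟩
  obtain ⟨x, hx, hxv⟩ := h.exists_ne v
  refine ⟨v, hv, _, isBranch_reachAvoid hxv, fun y hy hyv => h.reachAvoid hx hy hxv hyv, ?_⟩
  intro hvr hrx
  classical
  obtain ⟨p, hp⟩ := hconn.exists_walk_length_eq_dist v r
  have hpath := p.isPath_of_length_eq_dist hp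
  cases p with
  | nil => exact hvr rfl
  | cons hva q =>
    rename_i a
    rw [SimpleGraph.Walk.cons_isPath_iff] at hpath
    obtain ⟨q', hq'⟩ : ReachAvoid Γ v a x := ReachAvoid.trans ⟨q, hpath.2⟩ (ReachAvoid.symm hrx)
    have ha : a ∈ H.verts := by
      refine h.support_subset (p := .cons hva q'.bypass) ?_ hv hx (by simp)
      rw [SimpleGraph.Walk.cons_isPath_iff]
      exact ⟨q'.bypass_isPath, fun e => hq' (q'.support_bypass_subset_support e)⟩
    have h1 := hmin a ha
    have h2 := SimpleGraph.dist_le q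
    rw [← hp, SimpleGraph.Walk.length_cons] at h1
    omega

end IsPiece

theorem numPieces_le [Finite V] (hconn : Γ.Connected) {r s : V} (hrs : Γ.Adj r s) :
    numPieces Γ ≤ {p : V × Set V | IsFreeBranch Γ r s p.1 p.2}.ncard + 1 := by
  choose v hv C hC hHC hr using fun H : {H : Γ.Subgraph // IsPiece Γ H} =>
    H.2.exists_root hconn r
  have hinj : Function.Injective fun H => (v H, C H) := by
    intro H H' e
    simp only [Prod.mk.injEq] at e
    obtain ⟨a, ha, hav⟩ := H.2.exists_ne (v H)
    obtain ⟨b, hb, hbv⟩ := H'.2.exists_ne (v H')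
    refine Subtype.ext (H.2.eq_of_reachAvoid H'.2 (hv H) (e.1 ▸ hv H') ha hb ?_)
    exact (hC H).reachAvoid (hHC H a ha hav) (e.2 ▸ hHC H' b hb hbv)
  have hsub : Set.range (fun H => (v H, C H)) ⊆
      insert (r, {y | ReachAvoid Γ r s y}) {p : V × Set V | IsFreeBranch Γ r s p.1 p.2} := by
    rintro _ ⟨H, rfl⟩
    by_cases hs : s ∈ C H
    · left
      have hvr : v H = r := by
        by_contra hne
        exact hr H hne ((hC H).mem_of_adj hs hrs.symm (Ne.symm hne))
      have hCH := hC H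
      rw [hvr] at hCH
      exact Prod.ext hvr
        (hCH.eq_of_mem (isBranch_reachAvoid hrs.ne') hs (ReachAvoid.refl hrs.ne'))
    · right
      refine ⟨hC H, fun hrC => ?_, hs⟩
      by_cases hne : v H = r
      · exact (hC H).not_mem (hne ▸ hrC)
      · exact hr H hne hrC
  rw [numPieces, ← Set.ncard_range_of_injective hinj]
  exact (Set.ncard_le_ncard hsub (Set.toFinite _)).trans (Set.ncard_insert_le _ _)

theorem IsSelection.ncard_eq {S : Set V} (hS : IsSelection Γ S) : S.ncard = numMaxClasses Γ := by
  have hinj : Set.InjOn Γ.neighborSet S := fun v hv w hw e => hS.2.2 v hv w hw e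
  rw [numMaxClasses, ← hinj.ncard_image]
  congr 1
  ext L
  constructor
  · rintro ⟨v, hv, rfl⟩
    exact ⟨v, hS.1 v hv, rfl⟩
  · rintro ⟨v, hv, rfl⟩
    obtain ⟨w, hw, hwv⟩ := hS.2.1 v hv
    exact ⟨w, hw, hwv⟩

end Pieces

section LowerBound

variable {V : Type*} {Γ : SimpleGraph V}

theorem exists_isMaxVert_subset [Finite V] (v : V) :
    ∃ w, IsMaxVert Γ w ∧ Γ.neighborSet v ⊆ Γ.neighborSet w := by
  obtain ⟨w, hw, hmax⟩ := (Set.toFinite {w | Γ.neighborSet v ⊆ Γ.neighborSet w}).exists_maximalFor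
    Γ.neighborSet _ ⟨v, subset_refl (Γ.neighborSet v)⟩
  exact ⟨w, fun z hz => Set.Subset.antisymm (hmax (hw.trans hz) hz) hz, hw⟩

theorem exists_isSelection (Γ : SimpleGraph V) : ∃ S, IsSelection Γ S := by
  choose f hf hfL using fun L : {L : Set V // ∃ v, IsMaxVert Γ v ∧ Γ.neighborSet v = L} => L.2
  refine ⟨Set.range f, ?_, ?_, ?_⟩
  · rintro _ ⟨L, rfl⟩
    exact hf L
  · exact fun v hv => ⟨_, ⟨⟨_, v, hv, rfl⟩, rfl⟩, hfL _⟩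
  · rintro _ ⟨L, rfl⟩ _ ⟨L', rfl⟩ h
    rw [hfL, hfL] at h
    rw [Subtype.ext h]

theorem exists_adj_of_not_star (hconn : Γ.Connected)
    (hstar : ¬ ∃ v : V, ∀ w : V, w ≠ v → Γ.Adj v w) (w : V) : ∃ z, Γ.Adj w z := by
  by_contra! hcon
  refine hstar ⟨w, fun z hz => absurd ?_ hz⟩
  exact hconn.mem_of_closed (X := {w}) rfl (fun a ha b hab => absurd hab (ha ▸ hcon b)) z

namespace IsSelection

variable {S : Set V}

theorem exists_subset [Finite V] (hS : IsSelection Γ S) (v : V) :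
    ∃ w ∈ S, Γ.neighborSet v ⊆ Γ.neighborSet w := by
  obtain ⟨w, hw, hvw⟩ := exists_isMaxVert_subset (Γ := Γ) v
  obtain ⟨z, hz, hzw⟩ := hS.2.1 w hw
  exact ⟨z, hz, hzw ▸ hvw⟩

theorem exists_adj_ne (hS : IsSelection Γ S) (hconn : Γ.Connected)
    (hstar : ¬ ∃ v : V, ∀ w : V, w ≠ v → Γ.Adj v w) {v : V} (hv : v ∈ S) (u : V) :
    ∃ z, z ≠ u ∧ Γ.Adj v z := by
  by_contra! hcon
  have hvu : ∀ z, Γ.Adj v z → z = u := fun z hz => by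
    by_contra hne
    exact hcon z hne hz
  refine hstar ⟨u, fun w hw => ?_⟩
  have key : w ∈ insert u (Γ.neighborSet u) := by
    refine hconn.mem_of_closed (Set.mem_insert u _) ?_ w
    rintro a (rfl | ha) b hab
    · exact Or.inr hab
    · left
      have hsub : Γ.neighborSet v ⊆ Γ.neighborSet a := fun z hz => by
        rw [hvu z hz]
        exact SimpleGraph.Adj.symm ha
      have hb : b ∈ Γ.neighborSet v := hS.1 v hv a hsub ▸ hab
      exact hvu b hb
  exact key.resolve_left hw

theorem exists_edge [Finite V] (hS : IsSelection Γ S) (hconn : Γ.Connected)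
    (hstar : ¬ ∃ v : V, ∀ w : V, w ≠ v → Γ.Adj v w) (r : V) :
    ∃ s ∈ S, Γ.Adj r s := by
  obtain ⟨z, hz⟩ := exists_adj_of_not_star hconn hstar r
  obtain ⟨s, hs, hzs⟩ := hS.exists_subset z
  exact ⟨s, hs, (hzs hz.symm : Γ.Adj s r).symm⟩

theorem exists_multiplier [Finite V] (hS : IsSelection Γ S) (hconn : Γ.Connected) {r s : V}
    (hr : r ∈ S) (hs : s ∈ S) (hrs : r ≠ s) (u : V) :
    ∃ m ∈ S, Γ.Adj u m ∧ ∀ C, IsFreeBranch Γ r s u C → m ∉ C := by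
  obtain ⟨ρ, hρS, hρu, hρ⟩ :
      ∃ ρ ∈ S, ρ ≠ u ∧ ∀ C, IsFreeBranch Γ r s u C → ρ ∉ C := by
    by_cases hru : r = u
    · exact ⟨s, hs, fun h => hrs (hru.trans h.symm), fun C h => h.right_not_mem⟩
    · exact ⟨r, hr, hru, fun C h => h.left_not_mem⟩
  have hE := isBranch_reachAvoid (Γ := Γ) hρu
  have hEρ : ρ ∈ {y | ReachAvoid Γ u ρ y} := .refl hρu
  obtain ⟨y, hy, huy⟩ := hE.exists_adj hconn
  suffices ∃ m ∈ S, Γ.Adj u m ∧ m ∈ {y | ReachAvoid Γ u ρ y} by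
    obtain ⟨m, hm, hum, hmE⟩ := this
    refine ⟨m, hm, hum, fun C hC hmC => hρ C hC ?_⟩
    rwa [hC.isBranch.eq_of_mem hE hmC hmE]
  by_cases hyz : ∃ z, Γ.Adj y z ∧ z ≠ u
  · obtain ⟨z, hyz, hzu⟩ := hyz
    obtain ⟨m, hm, hym⟩ := hS.exists_subset y
    have hum : Γ.Adj m u := hym huy.symm
    have hmz : Γ.Adj m z := hym hyz
    exact ⟨m, hm, hum.symm, hE.mem_of_adj (hE.mem_of_adj hy hyz hzu) hmz.symm hum.ne⟩
  · push Not at hyz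
    rw [hE.eq_singleton hy hyz] at hEρ
    rw [Set.mem_singleton_iff] at hEρ
    subst hEρ
    exact ⟨ρ, hρS, huy, hy⟩

theorem exists_twistData [Finite V] (hS : IsSelection Γ S) (hconn : Γ.Connected)
    (htri : Γ.CliqueFree 3) (hstar : ¬ ∃ v : V, ∀ w : V, w ≠ v → Γ.Adj v w) {r s : V}
    (hr : r ∈ S) (hs : s ∈ S) (hrs : Γ.Adj r s) : ∃ m f, TwistData Γ S r s m f := by
  choose m hmS hm hmC using hS.exists_multiplier hconn hr hs hrs.ne
  have hf : ∀ w, ∃ v ∈ S, Γ.neighborSet w ⊆ Γ.neighborSet v ∧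
      ∀ u, w ∉ S → (∀ z, Γ.Adj w z → z = u) → v = m u := by
    intro w
    by_cases hw : ∃ u, ∀ z, Γ.Adj w z → z = u
    · obtain ⟨u, hu⟩ := hw
      refine ⟨m u, hmS u, fun z hz => ?_, fun u' _ hu' => ?_⟩
      · rw [hu z hz]
        exact (hm u).symm
      · obtain ⟨z, hz⟩ := exists_adj_of_not_star hconn hstar w
        rw [← hu z hz, ← hu' z hz]
    · obtain ⟨v, hv, hwv⟩ := hS.exists_subset w
      exact ⟨v, hv, hwv, fun u _ hu => absurd ⟨u, hu⟩ hw⟩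
  choose f hfS hfsub hf using hf
  exact ⟨m, f, {
    conn := hconn
    tri := fun a b c hab hbc hac => by
      classical
      exact htri {a, b, c} (SimpleGraph.is3Clique_triple_iff.mpr ⟨hab, hac, hbc⟩)
    exists_subset := hS.exists_subset
    exists_adj_ne := fun v hv u => hS.exists_adj_ne hconn hstar hv u
    left_mem := hr
    right_mem := hs
    adj := hrs
    m_mem := hmS
    m_adj := hm
    m_not_mem := hmC
    f_mem := hfS
    f_adj := fun w z hz => hfsub w hz
    f_eq := fun w u hw hu => hf w u hw hu }⟩

end IsSelection

namespace TwistData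

variable {S : Set V} {r s : V} {m f : V → V} (T : TwistData Γ S r s m f)
include T

theorem exists_detecting_of_not_isHub {v : V} (hub : ¬ IsHub Γ v) :
    ∃ x, v ≠ x ∧ ¬ Γ.Adj v x ∧ {D | IsBasicTwist Γ S r s m f v D 1 ∧ x ∈ D}.ncard = 0 := by
  simp only [IsHub, not_forall, not_or] at hub
  obtain ⟨x, ⟨H, hH, hvH, hxH⟩, hadj, hsub⟩ := hub
  refine ⟨x, ?_, hadj, ?_⟩
  · rintro rfl
    exact hsub subset_rfl
  rw [Set.eq_empty_of_forall_notMem (s := {D | _}), Set.ncard_empty]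
  rintro D ⟨h, hx⟩
  generalize ht : v = t at h
  cases h with
  | fold w _ hw _ =>
    rw [Set.mem_singleton_iff] at hx
    subst hx
    exact hsub fun z hz => ht ▸ T.f_adj x z hz
  | branch u _ hb hC =>
    have hvu : v ≠ u := ht ▸ T.m_ne u
    have hvD : v ∈ D := hb.isBranch.mem_of_reachAvoid hx
      (hH.reachAvoid hxH hvH (hb.isBranch.ne_of_mem hx) hvu)
    exact T.m_not_mem u D hb (ht ▸ hvD)

theorem finite_isBasicTwist [Finite V] :
    {τ : V × Set V × ℤ | IsBasicTwist Γ S r s m f τ.1 τ.2.1 τ.2.2}.Finite := by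
  refine (((Set.toFinite (Set.univ : Set V)).prod ((Set.toFinite (Set.univ : Set (Set V))).prod
    (Set.toFinite ({0, 1} : Set ℤ))))).subset ?_
  rintro ⟨t, D, ε⟩ h
  refine ⟨trivial, trivial, ?_⟩
  rcases (T.isTwist h).type with h | ⟨h, -⟩
  · exact Or.inr h
  · exact Or.inl h

theorem base_unique {u v : V} {C : Set V} (h : IsFreeBranch Γ r s u C)
    (h' : IsFreeBranch Γ r s v C) : u = v := by
  by_contra huv
  have := h.isBranch.disjoint h'.isBranch T.conn huv h'.isBranch.not_mem h.isBranch.not_mem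
  rw [disjoint_self, Set.bot_eq_empty] at this
  exact h.isBranch.nonempty.ne_empty this

theorem two_mul_add_le [Finite V] :
    2 * Sᶜ.ncard + {p : V × Set V | IsFreeBranch Γ r s p.1 p.2}.ncard ≤
      {τ : V × Set V × ℤ | IsBasicTwist Γ S r s m f τ.1 τ.2.1 τ.2.2}.ncard := by
  classical
  let F := {p : V × Set V | IsFreeBranch Γ r s p.1 p.2}
  let g : (↥Sᶜ × Bool) ⊕ F → V × Set V × ℤ := Sum.elim
    (fun q => (f q.1, {q.1.1}, if q.2 then 1 else 0))
    (fun p => if ∃ w, p.1.2 = {w} then (p.1.1, p.1.2, 0) else (m p.1.1, p.1.2, 1))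
  have hgD : ∀ p : F, (g (.inr p)).2.1 = p.1.2 := fun p => by
    simp only [g, Sum.elim_inr]
    split_ifs <;> rfl
  have hlr : ∀ q p, g (.inl q) ≠ g (.inr p) := by
    intro q ⟨⟨u, C⟩, hp⟩ e
    have hD : {q.1.1} = C := (congrArg (fun τ => τ.2.1) e).trans (hgD _)
    subst hD
    have hfu : f q.1 = u := by
      have := congrArg Prod.fst e
      simpa [g] using this
    have hadj := T.f_adj q.1 u ((hp.adj_iff_of_singleton T.conn u).mpr rfl)
    exact Γ.irrefl (hfu ▸ hadj)
  have hinj : Function.Injective g := by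
    rintro (⟨w, b⟩ | p) (⟨w', b'⟩ | p') e
    · simp only [g, Sum.elim_inl, Prod.mk.injEq, Set.singleton_eq_singleton_iff] at e
      obtain ⟨-, hw, hb⟩ := e
      have : b = b' := by
        cases b <;> cases b' <;> simp_all
      rw [Subtype.ext hw, this]
    · exact absurd e (hlr _ _)
    · exact absurd e.symm (hlr _ _)
    · have hC : p.1.2 = p'.1.2 := by rw [← hgD, e, hgD]
      have hp' : IsFreeBranch Γ r s p'.1.1 p.1.2 := hC ▸ p'.2
      rw [Subtype.ext (Prod.ext (T.base_unique p.2 hp') hC)]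
  have hmem : Set.range g ⊆
      {τ : V × Set V × ℤ | IsBasicTwist Γ S r s m f τ.1 τ.2.1 τ.2.2} := by
    rintro _ ⟨⟨w, b⟩ | ⟨⟨u, C⟩, hp⟩, rfl⟩
    · have hb : (if b then (1 : ℤ) else 0) = 0 ∨ (if b then (1 : ℤ) else 0) = 1 := by
        cases b <;> simp
      exact .fold w.1 _ w.2 hb
    · simp only [g, Sum.elim_inr, Set.mem_ofPred_eq]
      split_ifs with hC
      · obtain ⟨w, rfl⟩ := hC
        exact .leaf u w hp
      · exact .branch u C hp fun w hw => hC ⟨w, hw⟩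
  have hfin : {τ : V × Set V × ℤ | IsBasicTwist Γ S r s m f τ.1 τ.2.1 τ.2.2}.Finite :=
    T.finite_isBasicTwist
  have hcard := Set.ncard_le_ncard hmem hfin
  rw [Set.ncard_range_of_injective hinj, Nat.card_sum, Nat.card_prod] at hcard
  simpa [mul_comm, F] using hcard

theorem hasFreeAbelianSubgroupOfRank_of_le_ncard [Finite V] {xr xs : V} (hrx : ¬ Γ.Adj r xr)
    (hrne : r ≠ xr) (hsx : ¬ Γ.Adj s xs) (hsne : s ≠ xs) {n : ℕ}
    (hn : n ≤ {τ : V × Set V × ℤ | IsBasicTwist Γ S r s m f τ.1 τ.2.1 τ.2.2 ∧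
      ¬ (τ.2.2 = 1 ∧ τ.1 = r ∧ xr ∈ τ.2.1) ∧ ¬ (τ.2.2 = 1 ∧ τ.1 = s ∧ xs ∈ τ.2.1)}.ncard) :
    HasFreeAbelianSubgroupOfRank (OutG (RAAG Γ)) n := by
  set B := {τ : V × Set V × ℤ | IsBasicTwist Γ S r s m f τ.1 τ.2.1 τ.2.2 ∧
      ¬ (τ.2.2 = 1 ∧ τ.1 = r ∧ xr ∈ τ.2.1) ∧ ¬ (τ.2.2 = 1 ∧ τ.1 = s ∧ xs ∈ τ.2.1)}
  have hfin : Finite B := T.finite_isBasicTwist.subset fun τ hτ => hτ.1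
  obtain ⟨e⟩ : Nonempty (Fin n ↪ B) :=
    ⟨(Fin.castLEEmb hn).trans (Finite.equivFin B).symm.toEmbedding⟩
  have htw : ∀ i, IsBasicTwist Γ S r s m f (e i).1.1 (e i).1.2.1 (e i).1.2.2 :=
    fun i => (e i).2.1
  have hext : ∀ i j, (e i).1.1 = (e j).1.1 → (e i).1.2.1 = (e j).1.2.1 →
      (e i).1.2.2 = (e j).1.2.2 → i = j := fun i j h1 h2 h3 =>
    e.injective (Subtype.ext (Prod.ext h1 (Prod.ext h2 h3)))
  let F : TwistFamily Γ (Fin n) :=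
    { S := S
      t := fun i => (e i).1.1
      D := fun i => (e i).1.2.1
      ε := fun i => (e i).1.2.2
      isTwist := fun i => T.isTwist (htw i)
      commute := fun i j _ => T.commute (htw i) (htw j)
      t_mem := fun i => T.mult_mem (htw i)
      disjoint := fun i hi y hy => T.not_mem_of_eq_zero (htw i) hi hy }
  refine ⟨_, F.injective_outMk_comp_toAut T.left_mem T.right_mem
    (fun i => (T.root_not_mem (htw i)).1) (fun i => (T.root_not_mem (htw i)).2)
    (fun u hu => T.tri _ _ _ hu.1.symm T.adj hu.2.symm)
    hrx hrne (fun i h1 h2 h3 => (e i).2.2.1 ⟨h1, h2, h3⟩)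
    hsx hsne (fun i h1 h2 h3 => (e i).2.2.2 ⟨h1, h2, h3⟩) ?_ ?_⟩
  · intro i (hi : (e i).1.2.2 = 1)
    have hti := htw i
    rw [hi] at hti
    obtain ⟨x, hx, hadj⟩ := T.exists_witness hti
    refine ⟨x, hx, hadj, fun j hj => T.not_mem_of_mult_mem (htw i) (htw j) ?_, ?_⟩
    · rw [show (e j).1.1 = x from hj]
      exact hx
    · intro j hne (hj : (e j).1.2.2 = 1) (ht : (e j).1.1 = (e i).1.1) hxj
      have htj := htw j
      rw [hj, ht] at htj
      exact hne (hext j i ht (T.eq_of_mem htj hti hxj hx) (hj.trans hi.symm))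
  · intro i (hi : (e i).1.2.2 = 0)
    have hsing : ∀ j, (e j).1.2.2 = 0 → ∃ w, (e j).1.2.1 = {w} := fun j hj => by
      rcases (T.isTwist (htw j)).type with h | h
      · rw [hj] at h
        exact absurd h zero_ne_one
      · exact h.2
    obtain ⟨w, hw⟩ := hsing i hi
    refine ⟨w, show w ∈ (e i).1.2.1 by rw [hw]; rfl, ?_⟩
    intro j hne (hj : (e j).1.2.2 = 0) ht (hwj : w ∈ (e j).1.2.1)
    obtain ⟨w', hw'⟩ := hsing j hj
    rw [hw', Set.mem_singleton_iff] at hwj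
    subst hwj
    exact hne (hext j i ht (hw'.trans hw.symm) (hj.trans hi.symm))

theorem hasFreeAbelianSubgroupOfRank [Finite V] (hS : IsSelection Γ S) {xr xs : V}
    (hrx : ¬ Γ.Adj r xr) (hrne : r ≠ xr) (hsx : ¬ Γ.Adj s xs) (hsne : s ≠ xs) {n : ℕ}
    (hn : n ≤ (numPieces Γ - 1) + 2 * (Nat.card V - numMaxClasses Γ) -
      {D | IsBasicTwist Γ S r s m f r D 1 ∧ xr ∈ D}.ncard -
      {D | IsBasicTwist Γ S r s m f s D 1 ∧ xs ∈ D}.ncard) :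
    HasFreeAbelianSubgroupOfRank (OutG (RAAG Γ)) n := by
  refine T.hasFreeAbelianSubgroupOfRank_of_le_ncard hrx hrne hsx hsne (hn.trans ?_)
  set A := {τ : V × Set V × ℤ | IsBasicTwist Γ S r s m f τ.1 τ.2.1 τ.2.2} with hA
  set B := {τ : V × Set V × ℤ | IsBasicTwist Γ S r s m f τ.1 τ.2.1 τ.2.2 ∧
      ¬ (τ.2.2 = 1 ∧ τ.1 = r ∧ xr ∈ τ.2.1) ∧ ¬ (τ.2.2 = 1 ∧ τ.1 = s ∧ xs ∈ τ.2.1)} with hB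
  set R := {D | IsBasicTwist Γ S r s m f r D 1 ∧ xr ∈ D}
  set R' := {D | IsBasicTwist Γ S r s m f s D 1 ∧ xs ∈ D}
  have hcover : A ⊆ B ∪ (fun D => (r, D, (1 : ℤ))) '' R ∪ (fun D => (s, D, (1 : ℤ))) '' R' := by
    rintro ⟨t, D, ε⟩ hτ
    by_cases h1 : ε = 1 ∧ t = r ∧ xr ∈ D
    · obtain ⟨rfl, rfl, hx⟩ := h1
      exact Or.inl (Or.inr ⟨D, ⟨hτ, hx⟩, rfl⟩)
    by_cases h2 : ε = 1 ∧ t = s ∧ xs ∈ D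
    · obtain ⟨rfl, rfl, hx⟩ := h2
      exact Or.inr ⟨D, ⟨hτ, hx⟩, rfl⟩
    · exact Or.inl (Or.inl ⟨hτ, h1, h2⟩)
  have hBfin : B.Finite := T.finite_isBasicTwist.subset fun τ hτ => hτ.1
  have h1 := Set.ncard_le_ncard hcover
    ((hBfin.union (Set.toFinite _)).union (Set.toFinite _))
  have h2 := Set.ncard_union_le (B ∪ (fun D => (r, D, (1 : ℤ))) '' R)
    ((fun D => (s, D, (1 : ℤ))) '' R')
  have h3 := Set.ncard_union_le B ((fun D => (r, D, (1 : ℤ))) '' R)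
  have h4 := Set.ncard_image_le (f := fun D => (r, D, (1 : ℤ))) (Set.toFinite R)
  have h5 := Set.ncard_image_le (f := fun D => (s, D, (1 : ℤ))) (Set.toFinite R')
  have h6 := T.two_mul_add_le
  rw [← hA] at h6
  have h7 := numPieces_le T.conn T.adj
  have h8 := Set.ncard_add_ncard_compl S
  rw [hS.ncard_eq] at h8
  omega

theorem ncard_le_one [Finite V] (t x : V) :
    {D | IsBasicTwist Γ S r s m f t D 1 ∧ x ∈ D}.ncard ≤ 1 :=
  Set.ncard_le_one_iff_subsingleton.mpr fun _ h _ h' => T.eq_of_mem h.1 h'.1 h.2 h'.2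

theorem exists_detecting [Finite V] (hstar : ¬ ∃ v : V, ∀ w : V, w ≠ v → Γ.Adj v w) (v : V) :
    ∃ x, v ≠ x ∧ ¬ Γ.Adj v x ∧ {D | IsBasicTwist Γ S r s m f v D 1 ∧ x ∈ D}.ncard ≤ 1 := by
  push Not at hstar
  obtain ⟨x, hne, hadj⟩ := hstar v
  exact ⟨x, hne.symm, hadj, T.ncard_le_one v x⟩

end TwistData

end LowerBound

/-- Let `Γ` be a finite connected simple graph with no triangles
which is not the star of a single vertex.  Let `ν` be the number of vertices,
`ν₀` the number of maximal link-equivalence classes, and `π` the number of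
pieces of `Γ`.  Then `Out(A_Γ)` contains a free abelian subgroup of rank
`(π-1) + 2(ν-ν₀) - 2`.  If moreover `Γ₀` is a subgraph spanned by one chosen
vertex from each maximal equivalence class and some vertex of `Γ₀` is not a
hub, the rank improves to `(π-1) + 2(ν-ν₀) - 1`; and if some edge of `Γ₀` has
neither endpoint a hub, to `(π-1) + 2(ν-ν₀)`. -/
theorem out_raag_lower_bound_general
    {V : Type*} [Fintype V] (Γ : SimpleGraph V)
    (hconn : Γ.Connected) (htri : Γ.CliqueFree 3)
    (hstar : ¬ ∃ v : V, ∀ w : V, w ≠ v → Γ.Adj v w) :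
    HasFreeAbelianSubgroupOfRank (OutG (RAAG Γ))
      ((numPieces Γ - 1) + 2 * (Nat.card V - numMaxClasses Γ) - 2) ∧
    ∀ S₀ : Set V, IsSelection Γ S₀ →
      ((∃ v ∈ S₀, ¬ IsHub Γ v) →
        HasFreeAbelianSubgroupOfRank (OutG (RAAG Γ))
          ((numPieces Γ - 1) + 2 * (Nat.card V - numMaxClasses Γ) - 1)) ∧
      ((∃ v ∈ S₀, ∃ w ∈ S₀, Γ.Adj v w ∧ ¬ IsHub Γ v ∧ ¬ IsHub Γ w) →
        HasFreeAbelianSubgroupOfRank (OutG (RAAG Γ))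
          ((numPieces Γ - 1) + 2 * (Nat.card V - numMaxClasses Γ))) := by
  refine ⟨?_, fun S₀ hS => ⟨?_, ?_⟩⟩
  · obtain ⟨S₀, hS⟩ := exists_isSelection Γ
    obtain ⟨r, hr, -⟩ := hS.exists_subset hconn.nonempty.some
    obtain ⟨s, hs, hrs⟩ := hS.exists_edge hconn hstar r
    obtain ⟨m, f, T⟩ := hS.exists_twistData hconn htri hstar hr hs hrs
    obtain ⟨xr, hrne, hrx, h1⟩ := T.exists_detecting hstar r
    obtain ⟨xs, hsne, hsx, h2⟩ := T.exists_detecting hstar s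
    exact T.hasFreeAbelianSubgroupOfRank hS hrx hrne hsx hsne (by omega)
  · rintro ⟨r, hr, hub⟩
    obtain ⟨s, hs, hrs⟩ := hS.exists_edge hconn hstar r
    obtain ⟨m, f, T⟩ := hS.exists_twistData hconn htri hstar hr hs hrs
    obtain ⟨xr, hrne, hrx, h1⟩ := T.exists_detecting_of_not_isHub hub
    obtain ⟨xs, hsne, hsx, h2⟩ := T.exists_detecting hstar s
    exact T.hasFreeAbelianSubgroupOfRank hS hrx hrne hsx hsne (by omega)
  · rintro ⟨r, hr, s, hs, hrs, hub, hub'⟩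
    obtain ⟨m, f, T⟩ := hS.exists_twistData hconn htri hstar hr hs hrs
    obtain ⟨xr, hrne, hrx, h1⟩ := T.exists_detecting_of_not_isHub hub
    obtain ⟨xs, hsne, hsx, h2⟩ := T.exists_detecting_of_not_isHub hub'
    exact T.hasFreeAbelianSubgroupOfRank hS hrx hrne hsx hsne (by omega)
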